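/- arXiv:2506.13606 — 3 statements merged into one kernel-verified Lean document; each statement's English description precedes it below -/
import Mathlib

section
/- There exists a constant C > 0 such that for every finite non-piercing family ℱ of regions in the plane in general position, the transversal number satisfies τ(ℱ) ≤ C · ν(ℱ)^9, where ν(ℱ) is the matching number of ℱ. -/
open Set

/-- The plane ℝ². -/
abbrev Plane := ℝ × ℝ

/-- A Jordan curve: the image of a continuous injective map from the unit circle into ℝ². -/
def IsJordanCurve (S : Set Plane) : Prop :=
  ∃ f : Circle → Plane, Continuous f ∧ Function.Injective f ∧ Set.range f = S

/-- A region: a compact, connected subset of ℝ² whose frontier is the union of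
finitely many pairwise disjoint Jordan curves. -/
def IsRegion (F : Set Plane) : Prop :=
  IsCompact F ∧ IsConnected F ∧
    ∃ (n : ℕ) (γ : Fin n → Set Plane), (∀ i, IsJordanCurve (γ i)) ∧
      (Pairwise fun i j => Disjoint (γ i) (γ j)) ∧ frontier F = ⋃ i, γ i

/-- A family of regions is in general position if the frontiers of any two of its
members intersect in only finitely many points. -/
def GeneralPosition (ℱ : Set (Set Plane)) : Prop :=
  ∀ F ∈ ℱ, ∀ G ∈ ℱ, F ≠ G → (frontier F ∩ frontier G).Finite

/-- A family is non-piercing if the difference of any two of its members is connected. -/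
def NonPiercing (ℱ : Set (Set Plane)) : Prop :=
  ∀ F ∈ ℱ, ∀ G ∈ ℱ, F ≠ G → IsConnected (F \ G)

/-- The transversal number: the smallest cardinality of a set of points of the plane
meeting every member of the family. -/
noncomputable def transversalNumber (ℱ : Set (Set Plane)) : ℕ :=
  sInf {n | ∃ T : Finset Plane, T.card = n ∧ ∀ F ∈ ℱ, ∃ p ∈ T, p ∈ F}

/-- The matching number: the maximum number of pairwise disjoint members of the family. -/
noncomputable def matchingNumber (ℱ : Set (Set Plane)) : ℕ :=
  sSup {n | ∃ 𝒢 : Finset (Set Plane), ↑𝒢 ⊆ ℱ ∧ 𝒢.card = n ∧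
    (𝒢 : Set (Set Plane)).Pairwise Disjoint}

/-- The total variation of a continuous branch of `log (γ t - w)` along a path `γ`. -/
noncomputable def logVariation {x y : ℂ} (γ : Path x y) (w : ℂ) : ℂ :=
  open Classical in
  if h : ∃ g : ℝ → ℂ, Continuous g ∧ ∀ s, Complex.exp (g s) = γ.extend s - w then
    h.choose 1 - h.choose 0
  else 0

theorem logVariation_eq {x y w : ℂ} (γ : Path x y) {g : ℝ → ℂ} (hg : Continuous g)
    (h : ∀ s, Complex.exp (g s) = γ.extend s - w) : logVariation γ w = g 1 - g 0 := by
  have hex : ∃ g : ℝ → ℂ, Continuous g ∧ ∀ s, Complex.exp (g s) = γ.extend s - w := ⟨g, hg, h⟩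
  rw [logVariation, dif_pos hex]
  obtain ⟨hc, he⟩ := hex.choose_spec
  set k := hex.choose
  have hcov := Complex.isCoveringMap_exp.eq_of_comp_eq (g₁ := k)
    (g₂ := fun s => g s + (k 0 - g 0)) hc (by fun_prop) (by
      funext s
      apply Subtype.ext
      simp only [Function.comp_apply, Complex.exp_add, Complex.exp_sub]
      have h0 : Complex.exp (k 0) = Complex.exp (g 0) := by rw [h, he]
      rw [h0, div_self (Complex.exp_ne_zero _), mul_one, h, he]) 0 (by simp)
  rw [congrFun hcov 1]
  ring

theorem exists_continuous_exp_eq {X : Type*} [TopologicalSpace X] [LocallyPathConnectedSpace X]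
    [SimplyConnectedSpace X] {g : X → ℂ} (hg : Continuous g) (h0 : ∀ x, g x ≠ 0) :
    ∃ f : X → ℂ, Continuous f ∧ ∀ x, Complex.exp (f x) = g x := by
  obtain ⟨x₀⟩ : Nonempty X := inferInstance
  obtain ⟨f, ⟨-, hf⟩, -⟩ := Complex.isCoveringMapOn_exp.existsUnique_continuousMap_lifts
    (⟨g, hg⟩ : C(X, ℂ)) (a₀ := x₀) (Complex.exp_log (h0 x₀)) h0
  exact ⟨f, f.continuous, congrFun hf⟩

theorem exists_exp_eq_extend_sub {x y w : ℂ} (γ : Path x y) (h : ∀ t, γ t ≠ w) :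
    ∃ g : ℝ → ℂ, Continuous g ∧ ∀ s, Complex.exp (g s) = γ.extend s - w :=
  exists_continuous_exp_eq (by fun_prop) fun s => sub_ne_zero.2 (by
    simpa [Path.extend, IccExtend] using h _)

theorem exp_logVariation {x y w : ℂ} (γ : Path x y) (h : ∀ t, γ t ≠ w) :
    Complex.exp (logVariation γ w) = (y - w) / (x - w) := by
  obtain ⟨g, hg, hgw⟩ := exists_exp_eq_extend_sub γ h
  rw [logVariation_eq γ hg hgw, Complex.exp_sub, hgw, hgw]
  simp

/-- The intersection number of two paths, up to the factor `2 * π * I`. -/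
noncomputable def crossing {x y a b : ℂ} (α : Path x y) (β : Path a b) : ℂ :=
  logVariation α a - logVariation α b + logVariation β y - logVariation β x

theorem crossing_eq_zero_of_disjoint {x y a b : ℂ} (α : Path x y) (β : Path a b)
    (h : ∀ s t, α s ≠ β t) : crossing α β = 0 := by
  obtain ⟨G, hG, hGe⟩ := exists_continuous_exp_eq (X := ℝ × ℝ)
    (g := fun p => α.extend p.1 - β.extend p.2) (by fun_prop) fun p => sub_ne_zero.2 (by
      simpa [Path.extend, IccExtend] using h _ _)
  have h1 : logVariation α a = G (1, 0) - G (0, 0) :=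
    logVariation_eq α (g := fun s => G (s, 0)) (by fun_prop) fun s => by simp [hGe]
  have h2 : logVariation α b = G (1, 1) - G (0, 1) :=
    logVariation_eq α (g := fun s => G (s, 1)) (by fun_prop) fun s => by simp [hGe]
  have h3 : logVariation β y = (G (1, 1) + Real.pi * Complex.I) - (G (1, 0) + Real.pi * Complex.I) :=
    logVariation_eq β (g := fun t => G (1, t) + Real.pi * Complex.I) (by fun_prop) fun s => by
      simp [hGe, Complex.exp_add]
  have h4 : logVariation β x = (G (0, 1) + Real.pi * Complex.I) - (G (0, 0) + Real.pi * Complex.I) :=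
    logVariation_eq β (g := fun t => G (0, t) + Real.pi * Complex.I) (by fun_prop) fun s => by
      simp [hGe, Complex.exp_add]
  rw [crossing, h1, h2, h3, h4]
  ring

theorem exists_path_mem_of_isPreconnected {E : Type*} [TopologicalSpace E]
    [LocallyPathConnectedSpace E] {U S : Set E} (hS : IsPreconnected S) (hU : IsOpen U)
    (hSU : S ⊆ U) {x y : E} (hx : x ∈ S) (hy : y ∈ S) : ∃ γ : Path x y, ∀ t, γ t ∈ U := by
  have hc : IsConnected (connectedComponentIn U x) :=
    isConnected_connectedComponentIn_iff.2 (hSU hx)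
  have hp := (hU.connectedComponentIn.isConnected_iff_isPathConnected).1 hc
  have hsub := hS.subset_connectedComponentIn hx hSU
  obtain ⟨γ, hγ⟩ := hp.joinedIn x (hsub hx) y (hsub hy)
  exact ⟨γ, fun t => connectedComponentIn_subset _ _ (hγ t)⟩

open Filter Topology Metric in
theorem eventually_disjoint_thickening {E : Type*} [PseudoMetricSpace E] {x y : E} {F : Set E}
    (γ : Path x y) (hF : IsClosed F) (h : ∀ t, γ t ∉ F) :
    ∀ᶠ ε in 𝓝[>] (0 : ℝ), ∀ t, γ t ∉ thickening ε F := by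
  have hd : Disjoint (range γ) F := Set.disjoint_left.2 (by rintro _ ⟨t, rfl⟩; exact h t)
  obtain ⟨δ, hδ, hdis⟩ := hd.exists_thickenings (isCompact_range γ.continuous) hF
  filter_upwards [Ioo_mem_nhdsGT hδ] with ε hε t ht
  exact Set.disjoint_left.1 hdis (self_subset_thickening hδ _ ⟨t, rfl⟩)
    (thickening_mono hε.2.le _ ht)

open Filter Topology Metric in
/-- Paths close to `F` and `G`, with end points in `F \ G` and `G \ F` respectively, have
intersection number zero if `F \ G` and `G \ F` are connected. -/
theorem eventually_crossing_eq_zero {F G : Set ℂ} (hF : IsClosed F) (hG : IsClosed G)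
    (hGc : IsPreconnected G) (hFG : IsPreconnected (F \ G))
    (hGF : IsPreconnected (G \ F)) {x y a b : ℂ} (hx : x ∈ F \ G) (hy : y ∈ F \ G)
    (ha : a ∈ G \ F) (hb : b ∈ G \ F) :
    ∀ᶠ ε in 𝓝[>] (0 : ℝ), ∀ (α : Path x y) (β : Path a b),
      (∀ t, α t ∈ thickening ε F) → (∀ t, β t ∈ thickening ε G) → crossing α β = 0 := by
  obtain ⟨q, hq⟩ := exists_path_mem_of_isPreconnected hGF hF.isOpen_compl (fun z hz => hz.2) ha hb
  obtain ⟨r, hr⟩ := exists_path_mem_of_isPreconnected hFG hG.isOpen_compl (fun z hz => hz.2) hx hy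
  filter_upwards [eventually_disjoint_thickening q hF hq,
    eventually_disjoint_thickening r hG hr, self_mem_nhdsWithin] with ε hqε hrε hε α β hα hβ
  have hε : 0 < ε := hε
  obtain ⟨α', hα'⟩ := exists_path_mem_of_isPreconnected hFG
    (isOpen_thickening.inter hG.isOpen_compl)
    (fun z hz => ⟨self_subset_thickening hε F hz.1, hz.2⟩) hx hy
  obtain ⟨δ, hδ, hδε, hδpos⟩ := ((eventually_disjoint_thickening α' hG fun t => (hα' t).2).and
    ((eventually_le_nhds hε).filter_mono nhdsWithin_le_nhds |>.and
      eventually_mem_nhdsWithin)).exists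
  have hδpos : 0 < δ := hδpos
  obtain ⟨β', hβ'⟩ := exists_path_mem_of_isPreconnected hGc (isOpen_thickening (δ := δ))
    (self_subset_thickening hδpos G) ha.1 hb.1
  have e1 := crossing_eq_zero_of_disjoint α q fun s t h => hqε t (h ▸ hα s)
  have e2 := crossing_eq_zero_of_disjoint α' q fun s t h => hqε t (h ▸ (hα' s).1)
  have e3 := crossing_eq_zero_of_disjoint r β fun s t h => hrε s (h ▸ hβ t)
  have e4 := crossing_eq_zero_of_disjoint r β' fun s t h =>
    hrε s (h ▸ thickening_mono hδε _ (hβ' t))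
  have e5 := crossing_eq_zero_of_disjoint α' β' fun s t h => hδ s (h ▸ hβ' t)
  unfold crossing at *
  linear_combination e1 - e2 + e3 - e4 + e5

/-- The parity argument showing that `K₃,₃` is not planar. -/
theorem false_of_crossing_sums_eq_zero (m : Fin 3 ⊕ Fin 3 → Fin 3 ⊕ Fin 3 → ℤ)
    (n : Fin 3 → Fin 3 → Fin 3 ⊕ Fin 3 → ℤ)
    (hm : ∀ s t, s ≠ t → m s t + m t s = -1)
    (h : ∀ i j k l, i ≠ k → j ≠ l →
      m (.inr j) (.inl k) - m (.inl i) (.inl k) - m (.inr j) (.inr l) - m (.inr l) (.inl i) - 1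
        + n i j (.inl k) - n i j (.inr l) + n k l (.inr j) - n k l (.inl i) = 0) : False := by
  have e (j l : Fin 3) (hjl : j ≠ l) :=
    And.intro (h 0 j 1 l (by decide) hjl) (And.intro (h 0 j 2 l (by decide) hjl)
      (h 1 j 2 l (by decide) hjl))
  have e01 := e 0 1 (by decide)
  have e02 := e 0 2 (by decide)
  have e12 := e 1 2 (by decide)
  have e10 := e 1 0 (by decide)
  have e20 := e 2 0 (by decide)
  have e21 := e 2 1 (by decide)
  have m01 := hm (.inr 0) (.inr 1) (by decide)
  have m02 := hm (.inr 0) (.inr 2) (by decide)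
  have m12 := hm (.inr 1) (.inr 2) (by decide)
  omega

theorem exists_log_sub_eq {z w : ℂ} (h : z ≠ w) :
    ∃ m : ℤ, Complex.log (z - w) - Complex.log (w - z) = (2 * m + 1) * (Real.pi * Complex.I) := by
  have h1 : Complex.exp (Complex.log (z - w)) =
      Complex.exp (Complex.log (w - z) + Real.pi * Complex.I) := by
    rw [Complex.exp_add, Complex.exp_log (sub_ne_zero.2 h), Complex.exp_log
      (sub_ne_zero.2 h.symm), Complex.exp_pi_mul_I]
    ring
  obtain ⟨m, hm⟩ := Complex.exp_eq_exp_iff_exists_int.1 h1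
  exact ⟨m, by rw [hm]; ring⟩

theorem exists_logVariation_eq {x y w : ℂ} (γ : Path x y) (h : ∀ t, γ t ≠ w) :
    ∃ n : ℤ, logVariation γ w = Complex.log (y - w) - Complex.log (x - w)
      + n * (2 * Real.pi * Complex.I) := by
  refine Complex.exp_eq_exp_iff_exists_int.1 ?_
  rw [exp_logVariation γ h, Complex.exp_sub, Complex.exp_log, Complex.exp_log]
  · simpa [sub_ne_zero] using h 0
  · simpa [sub_ne_zero] using h 1

open Filter Topology Metric in
/-- Six closed connected sets in the plane with connected differences, each having a private point,
cannot intersect in the pattern `K₃,₃` with the intersections witnessed by points of depth two. -/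
theorem not_exists_depth_two_k33 (H : Fin 3 ⊕ Fin 3 → Set ℂ) (hcl : ∀ s, IsClosed (H s))
    (hconn : ∀ s, IsPreconnected (H s)) (hdiff : ∀ s t, s ≠ t → IsPreconnected (H s \ H t))
    (v : Fin 3 ⊕ Fin 3 → ℂ) (hv : ∀ s t, v s ∈ H t ↔ t = s)
    (p : Fin 3 → Fin 3 → ℂ) (hp : ∀ i j t, p i j ∈ H t ↔ t = .inl i ∨ t = .inr j) : False := by
  have hne (s t) (hst : s ≠ t) : v s ≠ v t := fun h =>
    hst ((hv t s).1 (h ▸ (hv s s).2 rfl))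
  have hmem (z : ℂ) (s) (hz : z ∉ H s) : ∀ᶠ ε in 𝓝[>] (0 : ℝ), z ∉ thickening ε (H s) :=
    (eventually_disjoint_thickening (Path.refl z) (hcl s) fun _ => hz).mono fun _ h => h 0
  have hev : ∀ᶠ ε in 𝓝[>] (0 : ℝ), ∀ s t, s ≠ t → v s ∉ thickening ε (H t) := by
    simp only [eventually_all]
    exact fun s t hst => hmem _ _ fun h => hst ((hv s t).1 h).symm
  have hcross {s t x y a b} (hst : s ≠ t) (hx : x ∈ H s \ H t) (hy : y ∈ H s \ H t)
      (ha : a ∈ H t \ H s) (hb : b ∈ H t \ H s) :=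
    eventually_crossing_eq_zero (hcl s) (hcl t) (hconn t) (hdiff s t hst)
      (hdiff t s hst.symm) hx hy ha hb
  have hvd (s t) (hst : s ≠ t) : v s ∈ H s \ H t := by simp [hv, hst.symm]
  have hpl (i j t) (h1 : t ≠ .inl i) (h2 : t ≠ .inr j) : p i j ∈ H (.inl i) \ H t := by
    simp [hp, h1, h2]
  have hpr (i j t) (h1 : t ≠ .inl i) (h2 : t ≠ .inr j) : p i j ∈ H (.inr j) \ H t := by
    simp [hp, h1, h2]
  have h1 : ∀ᶠ ε in 𝓝[>] (0 : ℝ), ∀ i j k l, i ≠ k → j ≠ l →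
      (∀ (α : Path (v (.inl i)) (p i j)) (β : Path (v (.inl k)) (p k l)),
        (∀ t, α t ∈ thickening ε (H (.inl i))) → (∀ t, β t ∈ thickening ε (H (.inl k))) →
          crossing α β = 0) ∧
      (∀ (α : Path (v (.inl i)) (p i j)) (β : Path (p k l) (v (.inr l))),
        (∀ t, α t ∈ thickening ε (H (.inl i))) → (∀ t, β t ∈ thickening ε (H (.inr l))) →
          crossing α β = 0) ∧
      (∀ (α : Path (p i j) (v (.inr j))) (β : Path (v (.inl k)) (p k l)),
        (∀ t, α t ∈ thickening ε (H (.inr j))) → (∀ t, β t ∈ thickening ε (H (.inl k))) →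
          crossing α β = 0) ∧
      (∀ (α : Path (p i j) (v (.inr j))) (β : Path (p k l) (v (.inr l))),
        (∀ t, α t ∈ thickening ε (H (.inr j))) → (∀ t, β t ∈ thickening ε (H (.inr l))) →
          crossing α β = 0) := by
    simp only [eventually_all]
    intro i j k l hik hjl
    have hik' := hik.symm
    have hjl' := hjl.symm
    refine (hcross ?_ (hvd _ _ ?_) (hpl _ _ _ ?_ ?_) (hvd _ _ ?_) (hpl _ _ _ ?_ ?_)).and <|
      (hcross ?_ (hvd _ _ ?_) (hpl _ _ _ ?_ ?_) (hpr _ _ _ ?_ ?_) (hvd _ _ ?_)).and <|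
      (hcross ?_ (hpr _ _ _ ?_ ?_) (hvd _ _ ?_) (hvd _ _ ?_) (hpl _ _ _ ?_ ?_)).and <|
      (hcross ?_ (hpr _ _ _ ?_ ?_) (hvd _ _ ?_) (hpr _ _ _ ?_ ?_) (hvd _ _ ?_)) <;> simp [*]
  obtain ⟨ε, ⟨hve, hε⟩, hpos⟩ := ((hev.and h1).and eventually_mem_nhdsWithin).exists
  have hpos : 0 < ε := hpos
  have hpath (s) {x y : ℂ} (hx : x ∈ H s) (hy : y ∈ H s) :
      ∃ γ : Path x y, ∀ t, γ t ∈ thickening ε (H s) :=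
    exists_path_mem_of_isPreconnected (hconn s) isOpen_thickening
      (self_subset_thickening hpos _) hx hy
  choose α hα using fun i j => hpath (.inl i) (x := v (.inl i)) (y := p i j)
    (by simp [hv]) (by simp [hp])
  choose β hβ using fun i j => hpath (.inr j) (x := p i j) (y := v (.inr j))
    (by simp [hp]) (by simp [hv])
  have hB (i j s) (h1 : s ≠ .inl i) (h2 : s ≠ .inr j) :
      ∃ n : ℤ, logVariation (α i j) (v s) + logVariation (β i j) (v s) =
        Complex.log (v (.inr j) - v s) - Complex.log (v (.inl i) - v s)
          + 2 * n * (Real.pi * Complex.I) := by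
    obtain ⟨n₁, hn₁⟩ := exists_logVariation_eq (α i j) (w := v s)
      fun t h => hve _ _ h1 (h ▸ hα i j t)
    obtain ⟨n₂, hn₂⟩ := exists_logVariation_eq (β i j) (w := v s)
      fun t h => hve _ _ h2 (h ▸ hβ i j t)
    exact ⟨n₁ + n₂, by rw [hn₁, hn₂]; push_cast; ring⟩
  choose! n hn using hB
  choose! m hm using fun s t (h : s ≠ t) => exists_log_sub_eq (hne s t h)
  have hpi : (Real.pi * Complex.I : ℂ) ≠ 0 := by simp [Real.pi_ne_zero]
  refine false_of_crossing_sums_eq_zero m n (fun s t hst => ?_) fun i j k l hik hjl => ?_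
  · have h : (2 * (m s t + m t s + 1) : ℂ) * (Real.pi * Complex.I) = 0 := by
      linear_combination - hm s t hst - hm t s hst.symm
    have h2 := (mul_eq_zero.1 h).resolve_right hpi
    norm_cast at h2
    omega
  · obtain ⟨c1, c2, c3, c4⟩ := hε i j k l hik hjl
    have c1 := c1 _ _ (hα i j) (hα k l)
    have c2 := c2 _ _ (hα i j) (hβ k l)
    have c3 := c3 _ _ (hβ i j) (hα k l)
    have c4 := c4 _ _ (hβ i j) (hβ k l)
    unfold crossing at c1 c2 c3 c4
    have h : (2 * (m (.inr j) (.inl k) - m (.inl i) (.inl k) - m (.inr j) (.inr l)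
        - m (.inr l) (.inl i) - 1 + n i j (.inl k) - n i j (.inr l) + n k l (.inr j)
        - n k l (.inl i)) : ℂ) * (Real.pi * Complex.I) = 0 := by
      linear_combination c1 + c2 + c3 + c4
        - hn i j (.inl k) (by simp [hik.symm]) (by simp)
        + hn i j (.inr l) (by simp) (by simp [hjl.symm])
        - hn k l (.inr j) (by simp) (by simp [hjl])
        + hn k l (.inl i) (by simp [hik]) (by simp)
        - hm (.inr j) (.inl k) (by simp) + hm (.inl i) (.inl k) (by simp [hik])
        + hm (.inr j) (.inr l) (by simp [hjl]) + hm (.inr l) (.inl i) (by simp)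
    have h2 := (mul_eq_zero.1 h).resolve_right hpi
    norm_cast at h2
    omega

/-- No four-by-four pattern of members `a i`, `b j` with points `p i j` that belong, among these
members, exactly to `a i` and `b j`. -/
def GridFree {V P : Type*} (S : V → Set P) : Prop :=
  ¬ ∃ (a b : Fin 4 → V) (p : Fin 4 → Fin 4 → P), ∀ i j k,
    (p i j ∈ S (a k) ↔ k = i) ∧ (p i j ∈ S (b k) ↔ k = j)

theorem GridFree.comp {V W P : Type*} {S : V → Set P} (h : GridFree S) (f : W → V) :
    GridFree (S ∘ f) := fun ⟨a, b, p, hp⟩ => h ⟨f ∘ a, f ∘ b, p, hp⟩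

theorem GridFree.preimage {V P Q : Type*} {S : V → Set P} (h : GridFree S) (f : Q → P) :
    GridFree fun v => f ⁻¹' S v := fun ⟨a, b, p, hp⟩ => h ⟨a, b, fun i j => f (p i j), hp⟩

theorem pow_four_le_descFactorial_add (n : ℕ) : n ^ 4 ≤ n.descFactorial 4 + 6 * n ^ 3 := by
  rcases n with _ | _ | _ | n
  · simp
  · simp [Nat.descFactorial]
  · simp [Nat.descFactorial]
  · simp only [Nat.descFactorial, Nat.sub_zero]
    rw [show n + 1 + 1 + 1 - 3 = n by omega, show n + 1 + 1 + 1 - 2 = n + 1 by omega,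
      show n + 1 + 1 + 1 - 1 = n + 2 by omega]
    ring_nf
    nlinarith [sq_nonneg n]

open Classical Finset in
/-- A quantitative **Kővári–Sós–Turán theorem** for `K₄,₄`. -/
theorem sum_card_pow_four_le {I : Type*} [Fintype I] (E : I → I → Prop)
    (h : ¬ ∃ a b : Fin 4 → I, Function.Injective a ∧ Function.Injective b ∧
      ∀ i j, E (a i) (b j)) :
    (∑ i, #{j | E i j}) ^ 4 ≤ 9 * Fintype.card I ^ 7 := by
  set N := Fintype.card I with hN
  have hjensen : (∑ i, #{j | E i j}) ^ 4 ≤ N ^ 3 * ∑ i, #{j | E i j} ^ 4 :=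
    pow_sum_le_card_mul_sum_pow (s := univ) (fun _ _ => Nat.zero_le _) 3
  have hcount : ∑ i, #{j | E i j} ^ 4 = ∑ b : Fin 4 → I, #{i | ∀ k, E i (b k)} := by
    have := sum_card_bipartiteAbove_eq_sum_card_bipartiteBelow (s := univ) (t := univ)
      (fun (i : I) (b : Fin 4 → I) => ∀ k, E i (b k))
    simp only [bipartiteAbove, bipartiteBelow] at this
    rw [← this]
    refine sum_congr rfl fun i _ => ?_
    have : ({b : Fin 4 → I | ∀ k, E i (b k)} : Finset _) =
        Fintype.piFinset fun _ => ({j | E i j} : Finset I) := by ext; simp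
    rw [this, Fintype.card_piFinset_const]
  have hinj (b : Fin 4 → I) (hb : Function.Injective b) : #{i | ∀ k, E i (b k)} ≤ 3 := by
    by_contra! h4
    obtain ⟨a⟩ := Function.Embedding.nonempty_of_card_le (α := Fin 4) (β := {i // ∀ k, E i (b k)})
      (by rw [Fintype.card_subtype, Fintype.card_fin]; exact h4)
    exact h ⟨fun i => a i, b, Subtype.val_injective.comp a.injective, hb, fun i => (a i).2⟩
  have hninj : #{b : Fin 4 → I | ¬ Function.Injective b} ≤ 6 * N ^ 3 := by
    have h1 := card_filter_add_card_filter_not (s := (univ : Finset (Fin 4 → I)))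
      (fun b => Function.Injective b)
    have h2 : #{b : Fin 4 → I | Function.Injective b} = N.descFactorial 4 := by
      rw [← Fintype.card_subtype, Fintype.card_congr (Equiv.subtypeInjectiveEquivEmbedding _ _),
        Fintype.card_embedding_eq]
      simp [hN]
    have h3 := pow_four_le_descFactorial_add N
    simp only [card_univ, Fintype.card_pi_const, ← hN] at h1
    omega
  have hsum : ∑ b : Fin 4 → I, #{i | ∀ k, E i (b k)} ≤ 9 * N ^ 4 := by
    calc ∑ b : Fin 4 → I, #{i | ∀ k, E i (b k)}
        ≤ ∑ b : Fin 4 → I, (3 + if ¬ Function.Injective b then N else 0) := by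
          refine sum_le_sum fun b _ => ?_
          by_cases hb : Function.Injective b
          · simpa [hb] using hinj b hb
          · simpa [hb] using (card_le_univ _).trans (Nat.le_add_left N 3)
      _ = N ^ 4 * 3 + #{b : Fin 4 → I | ¬ Function.Injective b} * N := by
          rw [sum_add_distrib, ← sum_filter]
          simp [hN]
      _ ≤ N ^ 4 * 3 + 6 * N ^ 3 * N := by gcongr
      _ = 9 * N ^ 4 := by ring
  calc (∑ i, #{j | E i j}) ^ 4 ≤ N ^ 3 * (9 * N ^ 4) := by
        rw [hcount] at hjensen
        exact hjensen.trans (by gcongr)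
    _ = 9 * N ^ 7 := by ring

open Classical Finset in
/-- If at most `n` of the nonempty sets `S y` can be pairwise disjoint, then many pairs meet. -/
theorem card_sq_le_mul_card_meeting_pairs {Y P : Type*} [Fintype Y] (S : Y → Set P) {n : ℕ}
    (hn : ∀ M : Finset Y, (∀ y ∈ M, ∀ z ∈ M, y ≠ z → Disjoint (S y) (S z)) → #M ≤ n)
    (hne : ∀ y, (S y).Nonempty) :
    Fintype.card Y ^ 2 ≤ 4 * n * #{q : Y × Y | (S q.1 ∩ S q.2).Nonempty} := by
  set d : Y → ℕ := fun y => #{z | (S y ∩ S z).Nonempty} with hd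
  have hpairs : #{q : Y × Y | (S q.1 ∩ S q.2).Nonempty} = ∑ y, d y := by
    rw [← univ_product_univ, Finset.card_filter, Finset.sum_product]
    simp only [hd, Finset.card_filter]
  set L : Finset Y := {y | 2 * n * d y < Fintype.card Y} with hL
  let 𝓜 : Finset (Finset Y) := {M ∈ L.powerset | ∀ y ∈ M, ∀ z ∈ M, y ≠ z → Disjoint (S y) (S z)}
  obtain ⟨M, hM, hmax⟩ := exists_max_image 𝓜 card ⟨∅, by simp [𝓜]⟩
  simp only [𝓜, Finset.mem_filter, Finset.mem_powerset] at hM hmax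
  have hcover : L ⊆ M.biUnion fun y => {z | (S y ∩ S z).Nonempty} := by
    intro z hz
    by_contra hcon
    simp only [Finset.mem_biUnion, Finset.mem_filter, Finset.mem_univ, true_and, not_exists, not_and,
      Set.not_nonempty_iff_eq_empty, ← Set.disjoint_iff_inter_eq_empty] at hcon
    have hzM : z ∉ M := fun h => (hne z).ne_empty (by simpa using hcon z h)
    have := hmax (insert z M) ⟨insert_subset hz hM.1, by
      intro y hy y' hy' hyy
      rcases mem_insert.1 hy with rfl | h1 <;> rcases mem_insert.1 hy' with rfl | h2
      · exact absurd rfl hyy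
      · exact (hcon _ h2).symm
      · exact hcon _ h1
      · exact hM.2 _ h1 _ h2 hyy⟩
    rw [card_insert_of_notMem hzM] at this
    omega
  have hLcard : 2 * #L * n ≤ n * Fintype.card Y := by
    calc 2 * #L * n ≤ 2 * (∑ y ∈ M, d y) * n := by
          gcongr
          exact (Finset.card_le_card hcover).trans card_biUnion_le
      _ = ∑ y ∈ M, 2 * n * d y := by rw [mul_sum, sum_mul]; exact sum_congr rfl fun _ _ => by ring
      _ ≤ ∑ y ∈ M, Fintype.card Y := sum_le_sum fun y hy => by
          have := hM.1 hy
          simp only [hL, Finset.mem_filter, Finset.mem_univ, true_and] at this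
          exact this.le
      _ = #M * Fintype.card Y := by simp
      _ ≤ n * Fintype.card Y := by gcongr; exact hn M hM.2
  rcases isEmpty_or_nonempty Y with hY | ⟨⟨y₀⟩⟩
  · simp
  have hnpos : 0 < n := Nat.lt_of_lt_of_le (by simp) (hn {y₀} (by simp))
  have hL2 : 2 * #L ≤ Fintype.card Y := by
    rw [mul_comm n] at hLcard
    exact Nat.le_of_mul_le_mul_right hLcard hnpos
  have hcompl := card_add_card_compl L
  have : #Lᶜ * Fintype.card Y ≤ 2 * n * ∑ y, d y := by
    calc #Lᶜ * Fintype.card Y = ∑ y ∈ Lᶜ, Fintype.card Y := by simp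
      _ ≤ ∑ y ∈ Lᶜ, 2 * n * d y := sum_le_sum fun y hy => by simpa [hL] using hy
      _ ≤ ∑ y, 2 * n * d y := sum_le_sum_of_subset (subset_univ _)
      _ = _ := by rw [mul_sum]
  rw [hpairs]
  nlinarith

open Classical Finset in
/-- The restriction of a uniformly random function to the range of an injection is uniform. -/
theorem card_filter_comp_mul {J K Y : Type*} [Fintype J] [Fintype K] [Fintype Y] {ι : J → K}
    (hι : Function.Injective ι) (T : Finset (J → Y)) :
    #{R : K → Y | R ∘ ι ∈ T} * Fintype.card Y ^ Fintype.card J =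
      #T * Fintype.card Y ^ Fintype.card K := by
  have hcomp (u : J → Y) (R : K → Y) : Function.extend ι u R ∘ ι = u :=
    funext fun j => hι.extend_apply _ _ j
  have h := card_nbij' (s := ({R : K → Y | R ∘ ι ∈ T} : Finset _) ×ˢ (univ : Finset (J → Y)))
    (t := T ×ˢ (univ : Finset (K → Y)))
    (fun q => (q.1 ∘ ι, Function.extend ι q.2 q.1)) (fun q => (Function.extend ι q.1 q.2, q.2 ∘ ι))
    (fun q hq => by simpa using hq) (fun q hq => by simpa [hcomp] using hq)
    (fun q _ => ?_) (fun q _ => ?_)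
  · simpa [card_product] using h
  · refine Prod.ext (funext fun k => ?_) (hcomp _ _)
    by_cases hk : ∃ j, ι j = k
    · obtain ⟨j, rfl⟩ := hk
      simp [hι.extend_apply]
    · simp [Function.extend_apply' _ _ _ hk]
  · refine Prod.ext (hcomp _ _) (funext fun k => ?_)
    by_cases hk : ∃ j, ι j = k
    · obtain ⟨j, rfl⟩ := hk
      simp [hι.extend_apply]
    · simp [Function.extend_apply' _ _ _ hk]

open Classical Finset in
theorem card_filter_apply_mul {K Y : Type*} [Fintype K] [Fintype Y] (i : K) (Q : Y → Prop) :
    #{R : K → Y | Q (R i)} * Fintype.card Y = #{y | Q y} * Fintype.card Y ^ Fintype.card K := by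
  have h := card_filter_comp_mul (ι := fun _ : Unit => i) (fun _ _ _ => rfl)
    ({u | Q (u ())} : Finset (Unit → Y))
  rw [show #{u : Unit → Y | Q (u ())} = #{y | Q y} from
    card_nbij' (fun u => u ()) (fun y _ => y) (by simp [Set.MapsTo]) (by simp [Set.MapsTo])
      (fun _ _ => rfl) (fun _ _ => rfl)] at h
  simpa using h

open Classical Finset in
theorem card_filter_apply₂_mul {K Y : Type*} [Fintype K] [Fintype Y] {i j : K} (hij : i ≠ j)
    (Q : Y → Y → Prop) :
    #{R : K → Y | Q (R i) (R j)} * Fintype.card Y ^ 2 =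
      #{q : Y × Y | Q q.1 q.2} * Fintype.card Y ^ Fintype.card K := by
  have h := card_filter_comp_mul (ι := ![i, j])
    (by intro a b; fin_cases a <;> fin_cases b <;> simp [hij, hij.symm])
    ({u | Q (u 0) (u 1)} : Finset (Fin 2 → Y))
  rw [show #{u : Fin 2 → Y | Q (u 0) (u 1)} = #{q : Y × Y | Q q.1 q.2} from
    card_nbij' (fun u => (u 0, u 1)) (fun q => ![q.1, q.2]) (by simp [Set.MapsTo])
      (by simp [Set.MapsTo])
      (fun u _ => by ext a; fin_cases a <;> rfl) (by simp [Set.LeftInvOn])] at h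
  simpa using h

open Classical Finset in
theorem card_filter_apply₃_mul {K Y : Type*} [Fintype K] [Fintype Y] {i j k : K} (hij : i ≠ j)
    (hik : i ≠ k) (hjk : j ≠ k) (Q : Y → Y → Y → Prop) :
    #{R : K → Y | Q (R i) (R j) (R k)} * Fintype.card Y ^ 3 =
      #{q : (Y × Y) × Y | Q q.1.1 q.1.2 q.2} * Fintype.card Y ^ Fintype.card K := by
  have h := card_filter_comp_mul (ι := ![i, j, k])
    (by intro a b; fin_cases a <;> fin_cases b <;>
          simp [hij, hij.symm, hik, hik.symm, hjk, hjk.symm])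
    ({u | Q (u 0) (u 1) (u 2)} : Finset (Fin 3 → Y))
  rw [show #{u : Fin 3 → Y | Q (u 0) (u 1) (u 2)} = #{q : (Y × Y) × Y | Q q.1.1 q.1.2 q.2} from
    card_nbij' (fun u => ((u 0, u 1), u 2)) (fun q => ![q.1.1, q.1.2, q.2])
      (by simp [Set.MapsTo]) (by simp [Set.MapsTo])
      (fun u _ => by ext a; fin_cases a <;> rfl) (by simp [Set.LeftInvOn])] at h
  simpa using h

open Classical Finset in
/-- The fractional Helly property of grid-free families, for the uniform measure. -/
theorem GridFree.exists_card_le_mul {Y P : Type*} [Fintype Y] [Nonempty Y] {S : Y → Set P}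
    (hS : GridFree S) {n : ℕ}
    (hn : ∀ M : Finset Y, (∀ y ∈ M, ∀ z ∈ M, y ≠ z → Disjoint (S y) (S z)) → #M ≤ n)
    (hne : ∀ y, (S y).Nonempty) :
    ∃ p, Fintype.card Y ≤ 160000 * n ^ 4 * #{y | p ∈ S y} := by
  obtain ⟨y₀⟩ : Nonempty Y := inferInstance
  have hnpos : 0 < n := Nat.lt_of_lt_of_le (by simp) (hn {y₀} (by simp))
  have : Nonempty P := ⟨(hne y₀).some⟩
  by_contra! hlt
  have hpt : ∀ y z, (S y ∩ S z).Nonempty → ∃ p, p ∈ S y ∧ p ∈ S z := fun _ _ h => h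
  choose! pt hpt using hpt
  set N := 40000 * n ^ 4 with hN
  set c := Fintype.card Y with hc
  have hcpos : 0 < c := Fintype.card_pos
  have hNpos : 0 < N := by positivity
  set D := #{q : Y × Y | (S q.1 ∩ S q.2).Nonempty} with hD
  have hDc : c ^ 2 ≤ 4 * n * D := card_sq_le_mul_card_meeting_pairs S hn hne
  set T := #{q : (Y × Y) × Y | (S q.1.1 ∩ S q.1.2).Nonempty ∧ pt q.1.1 q.1.2 ∈ S q.2} with hT
  have hTD : 4 * N * T ≤ D * c := by
    have : T = ∑ q : Y × Y with (S q.1 ∩ S q.2).Nonempty, #{y | pt q.1 q.2 ∈ S y} := by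
      rw [hT, Finset.card_filter, ← univ_product_univ, Finset.sum_product, Finset.sum_filter]
      refine sum_congr rfl fun q _ => ?_
      by_cases h : (S q.1 ∩ S q.2).Nonempty <;> simp [h]
    rw [this, mul_sum, hD, Finset.card_eq_sum_ones, sum_mul, one_mul]
    refine sum_le_sum fun q _ => ?_
    have := (hlt (pt q.1 q.2)).le
    calc _ = 160000 * n ^ 4 * #{y | pt q.1 q.2 ∈ S y} := by rw [hN]; ring
      _ ≤ c := this
  let good (R : Fin N ⊕ Fin N → Y) (i j : Fin N) : Prop :=
    (S (R (.inl i)) ∩ S (R (.inr j))).Nonempty ∧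
      ∀ k, k ≠ .inl i → k ≠ .inr j → pt (R (.inl i)) (R (.inr j)) ∉ S (R k)
  set M := c ^ Fintype.card (Fin N ⊕ Fin N) with hM
  have hgood (i j : Fin N) : M ≤ 8 * n * #{R | good R i j} := by
    have hA := card_filter_apply₂_mul (K := Fin N ⊕ Fin N) (i := .inl i) (j := .inr j) (by simp)
      fun y z => (S y ∩ S z).Nonempty
    set A := #{R : Fin N ⊕ Fin N → Y | (S (R (.inl i)) ∩ S (R (.inr j))).Nonempty}
    let b (k : Fin N ⊕ Fin N) : Finset (Fin N ⊕ Fin N → Y) :=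
      {R | (S (R (.inl i)) ∩ S (R (.inr j))).Nonempty ∧ pt (R (.inl i)) (R (.inr j)) ∈ S (R k)}
    have hB (k) (hik : Sum.inl i ≠ k) (hjk : Sum.inr j ≠ k) : 4 * N * (#(b k) * c ^ 2) ≤ D * M := by
      have h3 := card_filter_apply₃_mul (Y := Y) (i := Sum.inl i) (j := Sum.inr j) (by simp) hik hjk
        fun x y z => (S x ∩ S y).Nonempty ∧ pt x y ∈ S z
      refine Nat.le_of_mul_le_mul_right (c := c) ?_ hcpos
      calc 4 * N * (#(b k) * c ^ 2) * c = 4 * N * (#(b k) * c ^ 3) := by ring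
        _ = 4 * N * (T * M) := by congr 1; convert h3
        _ = 4 * N * T * M := by ring
        _ ≤ D * c * M := by gcongr
        _ = D * M * c := by ring
    have hAle : A ≤ #{R | good R i j} + ∑ k with Sum.inl i ≠ k ∧ Sum.inr j ≠ k, #(b k) := by
      refine (Finset.card_le_card ?_).trans ((Finset.card_union_le _ _).trans
        (Nat.add_le_add_left card_biUnion_le _))
      intro R hR
      simp only [Finset.mem_filter, Finset.mem_univ, true_and] at hR
      simp only [Finset.mem_union, Finset.mem_biUnion, Finset.mem_filter, Finset.mem_univ,
        true_and, b, good, hR]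
      by_contra! hcon
      obtain ⟨k, h1, h2, h3⟩ := hcon.1
      exact hcon.2 k ⟨h1.symm, h2.symm⟩ h3
    have hBsum : 2 * ((∑ k with Sum.inl i ≠ k ∧ Sum.inr j ≠ k, #(b k)) * c ^ 2) ≤ D * M := by
      refine Nat.le_of_mul_le_mul_left (c := 2 * N) ?_ (by positivity)
      calc 2 * N * (2 * ((∑ k with Sum.inl i ≠ k ∧ Sum.inr j ≠ k, #(b k)) * c ^ 2))
          = ∑ k with Sum.inl i ≠ k ∧ Sum.inr j ≠ k, 4 * N * (#(b k) * c ^ 2) := by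
            rw [← mul_sum, ← sum_mul]; ring
        _ ≤ ∑ k : Fin N ⊕ Fin N with Sum.inl i ≠ k ∧ Sum.inr j ≠ k, D * M := by
            refine sum_le_sum fun k hk => ?_
            simp only [Finset.mem_filter] at hk
            exact hB k hk.2.1 hk.2.2
        _ ≤ ∑ k : Fin N ⊕ Fin N, D * M := sum_le_sum_of_subset (filter_subset _ _)
        _ = 2 * N * (D * M) := by
            rw [Finset.sum_const, Finset.card_univ, Fintype.card_sum, Fintype.card_fin, smul_eq_mul]
            ring
    have h1 : D * M ≤ 2 * #{R | good R i j} * c ^ 2 := by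
      have := Nat.mul_le_mul_right (c ^ 2) hAle
      have hA' : A * c ^ 2 = D * M := by convert hA
      rw [hA', add_mul] at this
      linarith
    refine Nat.le_of_mul_le_mul_right (c := c ^ 2) ?_ (by positivity)
    calc M * c ^ 2 ≤ M * (4 * n * D) := by gcongr
      _ = 4 * n * (D * M) := by ring
      _ ≤ 4 * n * (2 * #{R | good R i j} * c ^ 2) := by gcongr
      _ = _ := by ring
  have hsum : ∑ R : Fin N ⊕ Fin N → Y, N ^ 2 ≤
      ∑ R : Fin N ⊕ Fin N → Y, 8 * n * ∑ i, #{j | good R i j} := by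
    calc ∑ R : Fin N ⊕ Fin N → Y, N ^ 2 = ∑ i : Fin N, ∑ j : Fin N, M := by
          simp [hM, hc]; ring
      _ ≤ ∑ i : Fin N, ∑ j : Fin N, 8 * n * #{R | good R i j} :=
          sum_le_sum fun i _ => sum_le_sum fun j _ => hgood i j
      _ = _ := by
          simp only [Finset.card_filter, mul_sum]
          rw [Finset.sum_comm (s := univ (α := Fin N ⊕ Fin N → Y))]
          exact sum_congr rfl fun i _ => Finset.sum_comm
  obtain ⟨R, -, hR⟩ := exists_le_of_sum_le univ_nonempty hsum
  have hkst := sum_card_pow_four_le (good R) (by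
    rintro ⟨a, b, ha, hb, hab⟩
    refine hS.comp R ⟨fun i => .inl (a i), fun j => .inr (b j),
      fun i j => pt (R (.inl (a i))) (R (.inr (b j))), fun i j k => ⟨⟨fun h => ?_, ?_⟩,
        ⟨fun h => ?_, ?_⟩⟩⟩
    · by_contra hk
      exact (hab i j).2 (.inl (a k)) (by simpa using fun h => hk (ha h)) (by simp) h
    · rintro rfl
      exact (hpt _ _ (hab k j).1).1
    · by_contra hk
      exact (hab i j).2 (.inr (b k)) (by simp) (by simpa using fun h => hk (hb h)) h
    · rintro rfl
      exact (hpt _ _ (hab i k).1).2)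
  rw [Fintype.card_fin] at hkst
  have h8 : N ^ 7 * N ≤ N ^ 7 * (36864 * n ^ 4) := by
    calc N ^ 7 * N = (N ^ 2) ^ 4 := by ring
      _ ≤ (8 * n * ∑ i, #{j | good R i j}) ^ 4 := by gcongr
      _ = 4096 * n ^ 4 * (∑ i, #{j | good R i j}) ^ 4 := by ring
      _ ≤ 4096 * n ^ 4 * (9 * N ^ 7) := Nat.mul_le_mul_left _ (by convert hkst)
      _ = _ := by ring
  have h9 := Nat.le_of_mul_le_mul_left h8 (by positivity)
  have : 0 < n ^ 4 := by positivity
  omega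

open Classical Finset in
/-- The fractional Helly property of grid-free families, for arbitrary weights. -/
theorem GridFree.exists_sum_le_mul {V P : Type*} [Fintype V] {S : V → Set P}
    (hS : GridFree S) {n : ℕ}
    (hn : ∀ M : Finset V, (∀ y ∈ M, ∀ z ∈ M, y ≠ z → Disjoint (S y) (S z)) → #M ≤ n)
    (hne : ∀ v, (S v).Nonempty) (w : V → ℕ) (hw : ∃ v, w v ≠ 0) :
    ∃ p, ∑ v, w v ≤ 160000 * n ^ 4 * ∑ v with p ∈ S v, w v := by
  obtain ⟨v₀, hv₀⟩ := hw
  have : Nonempty (Σ v, Fin (w v)) := ⟨⟨v₀, 0, Nat.pos_of_ne_zero hv₀⟩⟩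
  obtain ⟨p, hp⟩ := (hS.comp (Sigma.fst : (Σ v, Fin (w v)) → V)).exists_card_le_mul (n := n)
    (fun M hM => by
      have hinj : Set.InjOn Sigma.fst (M : Set (Σ v, Fin (w v))) := by
        intro y hy z hz hyz
        by_contra hne'
        have := hM y hy z hz hne'
        simp only [Function.comp_apply, hyz, disjoint_self] at this
        exact (hne z.1).ne_empty this
      rw [← card_image_of_injOn hinj]
      refine hn _ fun y hy z hz hyz => ?_
      obtain ⟨y, hyM, rfl⟩ := Finset.mem_image.1 hy
      obtain ⟨z, hzM, rfl⟩ := Finset.mem_image.1 hz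
      exact hM y hyM z hzM fun h => hyz (h ▸ rfl))
    (fun y => hne y.1)
  refine ⟨p, ?_⟩
  have h : #{y : Σ v, Fin (w v) | p ∈ (S ∘ Sigma.fst) y} = ∑ v with p ∈ S v, w v := by
    rw [Finset.card_filter, Fintype.sum_sigma, Finset.sum_filter]
    refine sum_congr rfl fun v _ => ?_
    by_cases hv : p ∈ S v <;> simp [hv]
  rw [h] at hp
  simpa using hp

open Classical Finset in
theorem exists_sum_two_pow_le {V P : Type*} [Fintype V] [Nonempty V] {S : V → Set P} {K : ℕ}
    (h : ∀ w : V → ℕ, (∃ v, w v ≠ 0) → ∃ p, ∑ v, w v ≤ K * ∑ v with p ∈ S v, w v) (t : ℕ) :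
    ∃ x : Fin t → P,
      (∑ v, 2 ^ #{s | x s ∉ S v} : ℝ) ≤ Fintype.card V * (2 - 1 / (K : ℝ)) ^ t := by
  induction t with
  | zero => exact ⟨Fin.elim0, by simp⟩
  | succ t ih =>
    obtain ⟨x, hx⟩ := ih
    obtain ⟨p, hp⟩ := h (fun v => 2 ^ #{s | x s ∉ S v}) ⟨Classical.arbitrary V, by positivity⟩
    have hK : 0 < K := by
      refine Nat.pos_of_ne_zero fun hK => ?_
      simp [hK] at hp
    have hK1 : (1 : ℝ) / K ≤ 1 := by
      rw [div_le_one (by positivity)]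
      exact_mod_cast hK
    refine ⟨Fin.cons p x, ?_⟩
    have hstep (v : V) : (2 : ℝ) ^ #{s | Fin.cons (α := fun _ => P) p x s ∉ S v} =
        2 * 2 ^ #{s | x s ∉ S v} - if p ∈ S v then 2 ^ #{s | x s ∉ S v} else 0 := by
      rw [Fin.card_filter_univ_succ]
      by_cases hv : p ∈ S v
      · simp [hv]; ring
      · simp [hv, pow_succ]; ring
    have hp' : (∑ v, 2 ^ #{s | x s ∉ S v} : ℝ) ≤
        K * ∑ v with p ∈ S v, 2 ^ #{s | x s ∉ S v} := by exact_mod_cast hp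
    have hdiv : 1 / (K : ℝ) * (∑ v, 2 ^ #{s | x s ∉ S v} : ℝ) ≤
        ∑ v with p ∈ S v, 2 ^ #{s | x s ∉ S v} := by
      rw [one_div, inv_mul_le_iff₀ (by positivity)]
      exact hp'
    calc (∑ v, 2 ^ #{s | Fin.cons (α := fun _ => P) p x s ∉ S v} : ℝ)
        = 2 * (∑ v, 2 ^ #{s | x s ∉ S v} : ℝ) - ∑ v with p ∈ S v, 2 ^ #{s | x s ∉ S v} := by
          simp only [hstep, sum_sub_distrib, mul_sum, Finset.sum_filter]
      _ ≤ (2 - 1 / (K : ℝ)) * (∑ v, 2 ^ #{s | x s ∉ S v} : ℝ) := by linarith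
      _ ≤ (2 - 1 / (K : ℝ)) * (Fintype.card V * (2 - 1 / (K : ℝ)) ^ t) := by
          gcongr
          linarith
      _ = _ := by ring

open Classical Finset in
/-- A fractional transversal, written as a uniformly distributed sequence of points. It is found
by the multiplicative weights method. -/
theorem exists_uniform_hitting {V P : Type*} [Fintype V] [Nonempty V] {S : V → Set P} {K : ℕ}
    (hK : 0 < K)
    (h : ∀ w : V → ℕ, (∃ v, w v ≠ 0) → ∃ p, ∑ v, w v ≤ K * ∑ v with p ∈ S v, w v) :
    ∃ t > 0, ∃ x : Fin t → P, ∀ v, t ≤ 4 * K * #{s | x s ∈ S v} := by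
  set l := Real.log (Fintype.card V) with hl
  set t := ⌈4 * K * l⌉₊ + 1 with ht
  obtain ⟨x, hx⟩ := exists_sum_two_pow_le h t
  refine ⟨t, by omega, x, fun v => ?_⟩
  have hKR : (0 : ℝ) < K := by exact_mod_cast hK
  have hK1 : (1 : ℝ) / K ≤ 1 := by
    rw [div_le_one hKR]
    exact_mod_cast hK
  have htl : 4 * K * l ≤ t := (Nat.le_ceil _).trans (by simp [ht])
  set a := #{s | x s ∈ S v} with ha
  set b := #{s | x s ∉ S v} with hb
  have hab : a + b = t := by
    have := card_filter_add_card_filter_not (s := (univ : Finset (Fin t))) (fun s => x s ∈ S v)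
    simpa [ha, hb] using this
  have hcard : (0 : ℝ) < Fintype.card V := by exact_mod_cast Fintype.card_pos
  have h1 : (2 : ℝ) ^ b ≤ Fintype.card V * (2 - 1 / (K : ℝ)) ^ t :=
    (single_le_sum (f := fun v => (2 : ℝ) ^ #{s | x s ∉ S v}) (fun _ _ => by positivity)
      (Finset.mem_univ v)).trans hx
  have h2 : (2 - 1 / (K : ℝ)) ^ t ≤ 2 ^ t * Real.exp (-(t / (2 * K))) := by
    calc (2 - 1 / (K : ℝ)) ^ t ≤ (2 * Real.exp (-(1 / (2 * K)))) ^ t := by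
          gcongr
          · linarith
          · have := Real.add_one_le_exp (-(1 / (2 * (K : ℝ))))
            have e : 1 / (K : ℝ) = 2 * (1 / (2 * K)) := by field_simp
            linarith
      _ = _ := by
          rw [mul_pow, ← Real.exp_nat_mul]
          congr 2
          ring
  have h3 : Real.exp (t / (2 * K)) ≤ Real.exp (l + a) := by
    have hexp : (2 : ℝ) ^ a ≤ Real.exp a := by
      rw [← Real.exp_one_pow]
      gcongr
      have := Real.add_one_le_exp (1 : ℝ)
      linarith
    have : (2 : ℝ) ^ b * 1 ≤ 2 ^ b * (Fintype.card V * 2 ^ a * Real.exp (-(t / (2 * K)))) := by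
      calc (2 : ℝ) ^ b * 1 ≤ Fintype.card V * (2 ^ t * Real.exp (-(t / (2 * K)))) := by
            rw [mul_one]
            exact h1.trans (by gcongr)
        _ = _ := by rw [← hab, pow_add]; push_cast; ring
    have := le_of_mul_le_mul_left this (by positivity)
    rw [Real.exp_neg, ← div_eq_mul_inv, le_div_iff₀ (Real.exp_pos _), one_mul] at this
    rw [Real.exp_add, hl, Real.exp_log hcard]
    exact this.trans (by gcongr)
  have h4 := Real.exp_le_exp.1 h3
  rw [div_le_iff₀ (by positivity)] at h4
  have : (t : ℝ) ≤ 4 * K * a := by nlinarith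
  exact_mod_cast this

open Classical Finset in
/-- Grid-free families have Vapnik–Chervonenkis dimension at most `15`, hence few traces. -/
theorem GridFree.card_traces_le {V A : Type*} [Fintype V] [Fintype A] [Nonempty A] {S : V → Set A}
    (hS : GridFree S) :
    #(univ.image fun v => ({x | x ∈ S v} : Finset A)) ≤ 16 * Fintype.card A ^ 15 := by
  set 𝒜 : Finset (Finset A) := univ.image fun v => ({x | x ∈ S v} : Finset A) with h𝒜
  have hvc : 𝒜.vcDim ≤ 15 := by
    refine Finset.sup_le fun s hs => ?_
    by_contra! h16
    obtain ⟨s', hs's, hs'⟩ := exists_subset_card_eq (show 16 ≤ #s from h16)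
    have hsh : 𝒜.Shatters s' := (mem_shatterer.1 hs).mono_right hs's
    let e : Fin 4 × Fin 4 ≃ s' := Fintype.equivOfCardEq (by simp [hs'])
    have key (Q : Fin 4 × Fin 4 → Prop) : ∃ v, ∀ q, (e q : A) ∈ S v ↔ Q q := by
      obtain ⟨u, hu, hsu⟩ := @hsh (({q | Q q} : Finset _).image fun q => (e q : A)) (by
        intro x hx
        obtain ⟨q, -, rfl⟩ := Finset.mem_image.1 hx
        exact (e q).2)
      obtain ⟨v, -, rfl⟩ := Finset.mem_image.1 hu
      refine ⟨v, fun q => ?_⟩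
      have := Finset.ext_iff.1 hsu (e q)
      simpa using this
    choose a ha using fun k => key fun q => q.1 = k
    choose b hb using fun k => key fun q => q.2 = k
    exact hS ⟨a, b, fun i j => e (i, j), fun i j k =>
      ⟨(ha k (i, j)).trans eq_comm, (hb k (i, j)).trans eq_comm⟩⟩
  calc #𝒜 ≤ #𝒜.shatterer := card_le_card_shatterer 𝒜
    _ ≤ ∑ k ∈ Finset.Iic 𝒜.vcDim, (Fintype.card A).choose k := card_shatterer_le_sum_vcDim
    _ ≤ ∑ k ∈ Finset.Iic 𝒜.vcDim, Fintype.card A ^ 15 := by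
        refine sum_le_sum fun k hk => (Nat.choose_le_pow _ _).trans ?_
        exact Nat.pow_le_pow_right Fintype.card_pos ((Finset.mem_Iic.1 hk).trans hvc)
    _ = (𝒜.vcDim + 1) * Fintype.card A ^ 15 := by simp
    _ ≤ 16 * Fintype.card A ^ 15 := by gcongr; omega

open Classical Finset in
theorem card_separating_swaps_mul_le {m : ℕ} (T : Set (Fin m × Bool)) (L : ℕ) :
    #{σ : Fin m → Bool | (∀ i, (i, σ i) ∉ T) ∧ L ≤ #{i | (i, !σ i) ∈ T}} * 2 ^ L ≤ 2 ^ m := by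
  set G : Finset (Fin m → Bool) := {σ | (∀ i, (i, σ i) ∉ T) ∧ L ≤ #{i | (i, !σ i) ∈ T}} with hG
  rcases G.eq_empty_or_nonempty with h0 | ⟨σ, hσ⟩
  · simp [h0]
  have hσ' := hσ
  simp only [hG, Finset.mem_filter, Finset.mem_univ, true_and] at hσ'
  have hsub : G ⊆ Fintype.piFinset fun i => if (i, !σ i) ∈ T then {σ i} else univ := by
    intro τ hτ
    simp only [hG, Finset.mem_filter, Finset.mem_univ, true_and] at hτ
    rw [Fintype.mem_piFinset]
    intro i
    split_ifs with hi
    · rw [Finset.mem_singleton]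
      by_contra hne
      refine hτ.1 i ?_
      rwa [show τ i = !σ i by cases h1 : τ i <;> cases h2 : σ i <;> simp_all]
    · exact Finset.mem_univ _
  have hpow : 2 ^ #{i | (i, !σ i) ∈ T} = ∏ i, if (i, !σ i) ∈ T then 2 else 1 := by
    rw [← Finset.prod_filter]
    simp
  calc #G * 2 ^ L ≤ #(Fintype.piFinset fun i => if (i, !σ i) ∈ T then {σ i} else univ) *
        2 ^ #{i | (i, !σ i) ∈ T} :=
        Nat.mul_le_mul (Finset.card_le_card hsub) (Nat.pow_le_pow_right two_pos hσ'.2)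
    _ = ∏ _i : Fin m, 2 := by
        rw [Fintype.card_piFinset, hpow, ← prod_mul_distrib]
        refine prod_congr rfl fun i _ => ?_
        split_ifs <;> simp
    _ = 2 ^ m := by simp

open Classical Finset in
/-- If `Q` has density at least `1 / k`, then many samples of length `2 * k * L` hit `Q` at least
`L` times. -/
theorem card_pow_le_mul_card_hits {X : Type*} [Fintype X] [Nonempty X] (Q : X → Prop) {k L : ℕ}
    (hk : 0 < k) (hL : 0 < L) (hQ : Fintype.card X ≤ k * #{x | Q x}) :
    Fintype.card X ^ (2 * k * L) ≤
      2 * k * #{y : Fin (2 * k * L) → X | L ≤ #{i | Q (y i)}} := by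
  set m := 2 * k * L with hm
  set c := Fintype.card X with hc
  have hcpos : 0 < c := Fintype.card_pos
  have hswap : (∑ y : Fin m → X, #{i | Q (y i)}) * c = m * (#{x | Q x} * c ^ m) := by
    have : ∑ y : Fin m → X, #{i | Q (y i)} = ∑ i, #{y : Fin m → X | Q (y i)} := by
      simp only [Finset.card_filter]
      exact Finset.sum_comm
    rw [this, sum_mul]
    calc ∑ i, #{y : Fin m → X | Q (y i)} * c = ∑ i : Fin m, #{x | Q x} * c ^ m := by
          refine sum_congr rfl fun i _ => ?_
          have := card_filter_apply_mul i Q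
          rw [Fintype.card_fin] at this
          convert this
      _ = _ := by simp
  have hlow : 2 * L * c ^ m ≤ ∑ y : Fin m → X, #{i | Q (y i)} := by
    refine Nat.le_of_mul_le_mul_right (c := k * c) ?_ (by positivity)
    calc 2 * L * c ^ m * (k * c) = m * (c * c ^ m) := by rw [hm]; ring
      _ ≤ m * (k * #{x | Q x} * c ^ m) := by gcongr
      _ = k * (m * (#{x | Q x} * c ^ m)) := by ring
      _ = _ := by rw [← hswap]; ring
  have hup : ∑ y : Fin m → X, #{i | Q (y i)} ≤
      #{y : Fin m → X | L ≤ #{i | Q (y i)}} * m + L * c ^ m := by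
    calc ∑ y : Fin m → X, #{i | Q (y i)}
        ≤ ∑ y : Fin m → X, ((if L ≤ #{i | Q (y i)} then m else 0) + L) := by
          refine sum_le_sum fun y _ => ?_
          split_ifs with h
          · exact (card_le_univ _).trans (by simp)
          · omega
      _ = _ := by
          rw [sum_add_distrib, ← sum_filter]
          simp [hc, mul_comm]
  refine Nat.le_of_mul_le_mul_left (c := L) ?_ hL
  calc L * c ^ m ≤ #{y : Fin m → X | L ≤ #{i | Q (y i)}} * m := by linarith
    _ = _ := by rw [hm]; ring

/-- The double samples `z` for which some member of `S` misses the first half and meets the second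
half at least `L` times. -/
def badSamples {V X : Type*} (S : V → Set X) (m L : ℕ) : Set (Fin m × Bool → X) :=
  {z | ∃ v, (∀ i, z (i, false) ∉ S v) ∧ L ≤ {i | z (i, true) ∈ S v}.ncard}

/-- Exchange the two halves of a double sample in the positions marked by `σ`. -/
def swapHalves {m : ℕ} (σ : Fin m → Bool) (j : Fin m × Bool) : Fin m × Bool :=
  (j.1, j.2 ^^ σ j.1)

theorem swapHalves_comp_swapHalves {m : ℕ} (σ : Fin m → Bool) : swapHalves σ ∘ swapHalves σ = id := by
  ext j <;> simp [swapHalves]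

open Classical Finset in
theorem GridFree.card_swaps_mem_badSamples_mul_le {V X : Type*} [Fintype V] {S : V → Set X}
    (hS : GridFree S) {m : ℕ} (hm : 0 < m) (L : ℕ) (z : Fin m × Bool → X) :
    #{σ | z ∘ swapHalves σ ∈ badSamples S m L} * 2 ^ L ≤ 16 * (2 * m) ^ 15 * 2 ^ m := by
  have : Nonempty (Fin m × Bool) := ⟨⟨⟨0, hm⟩, true⟩⟩
  set 𝒯 := Finset.univ.image fun v => ({j | j ∈ z ⁻¹' S v} : Finset (Fin m × Bool)) with h𝒯
  have htr : #𝒯 ≤ 16 * (2 * m) ^ 15 := by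
    have := (hS.preimage z).card_traces_le
    rw [Fintype.card_prod, Fintype.card_fin, Fintype.card_bool, mul_comm m] at this
    convert this
  have hsub : ({σ | z ∘ swapHalves σ ∈ badSamples S m L} : Finset (Fin m → Bool)) ⊆ 𝒯.biUnion fun T =>
      {σ | (∀ i, (i, σ i) ∉ (T : Set (Fin m × Bool))) ∧
        L ≤ #{i | (i, !σ i) ∈ (T : Set (Fin m × Bool))}} := by
    intro σ hσ
    simp only [Finset.mem_filter, Finset.mem_univ, true_and] at hσ
    obtain ⟨v, h1, h2⟩ := hσ
    rw [Set.ncard_eq_toFinset_card'] at h2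
    refine Finset.mem_biUnion.2 ⟨_, Finset.mem_image_of_mem _ (Finset.mem_univ v), ?_⟩
    simpa [swapHalves] using And.intro h1 h2
  calc #{σ | z ∘ swapHalves σ ∈ badSamples S m L} * 2 ^ L
      ≤ (∑ T ∈ 𝒯, #{σ : Fin m → Bool | (∀ i, (i, σ i) ∉ (T : Set (Fin m × Bool))) ∧
        L ≤ #{i | (i, !σ i) ∈ (T : Set (Fin m × Bool))}}) * 2 ^ L := by
        gcongr
        exact (Finset.card_le_card hsub).trans card_biUnion_le
    _ ≤ ∑ T ∈ 𝒯, 2 ^ m := by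
        rw [sum_mul]
        exact sum_le_sum fun T _ => by
          refine le_of_eq_of_le ?_ (card_separating_swaps_mul_le (T : Set (Fin m × Bool)) L)
          congr!
    _ = #𝒯 * 2 ^ m := by simp
    _ ≤ _ := by gcongr

open Classical Finset in
theorem GridFree.card_badSamples_mul_le {V X : Type*} [Fintype V] [Fintype X] {S : V → Set X}
    (hS : GridFree S) {m : ℕ} (hm : 0 < m) (L : ℕ) :
    #{z | z ∈ badSamples S m L} * 2 ^ L ≤
      16 * (2 * m) ^ 15 * (Fintype.card X ^ m * Fintype.card X ^ m) := by
  have hinv (σ : Fin m → Bool) : #{z : Fin m × Bool → X | z ∘ swapHalves σ ∈ badSamples S m L} =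
      #{z | z ∈ badSamples S m L} :=
    card_nbij' (fun z => z ∘ swapHalves σ) (fun z => z ∘ swapHalves σ) (by simp [Set.MapsTo])
      (by simp [Set.MapsTo, Function.comp_assoc, swapHalves_comp_swapHalves])
      (fun z _ => by simp [Function.comp_assoc, swapHalves_comp_swapHalves])
      (fun z _ => by simp [Function.comp_assoc, swapHalves_comp_swapHalves])
  have hswap : ∑ σ : Fin m → Bool, #{z : Fin m × Bool → X | z ∘ swapHalves σ ∈ badSamples S m L} =
      ∑ z : Fin m × Bool → X, #{σ | z ∘ swapHalves σ ∈ badSamples S m L} := by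
    simp only [Finset.card_filter]
    exact Finset.sum_comm
  rw [sum_congr rfl fun σ _ => hinv σ, sum_const, card_univ, Fintype.card_fun, Fintype.card_bool,
    Fintype.card_fin, smul_eq_mul] at hswap
  refine Nat.le_of_mul_le_mul_left (c := 2 ^ m) ?_ (by positivity)
  rw [← mul_assoc, hswap, sum_mul]
  calc ∑ z : Fin m × Bool → X, #{σ | z ∘ swapHalves σ ∈ badSamples S m L} * 2 ^ L
      ≤ ∑ z : Fin m × Bool → X, 16 * (2 * m) ^ 15 * 2 ^ m :=
        sum_le_sum fun z _ => hS.card_swaps_mem_badSamples_mul_le hm L z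
    _ = _ := by
        rw [sum_const, card_univ, Fintype.card_fun, Fintype.card_prod, Fintype.card_bool,
          Fintype.card_fin, smul_eq_mul]
        ring

open Classical Finset in
/-- If every sample of length `2 * k * L` misses a member of `S`, then many double samples are
bad. -/
theorem pow_mul_pow_le_mul_card_badSamples {V X : Type*} [Fintype X] [Nonempty X] {S : V → Set X}
    {k L : ℕ} (hk : 0 < k) (hL : 0 < L) (h : ∀ v, Fintype.card X ≤ k * #{x | x ∈ S v})
    (hno : ∀ x : Fin (2 * k * L) → X, ∃ v, ∀ i, x i ∉ S v) :
    Fintype.card X ^ (2 * k * L) * Fintype.card X ^ (2 * k * L) ≤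
      2 * k * #{z | z ∈ badSamples S (2 * k * L) L} := by
  choose v hv using hno
  let P (x y : Fin (2 * k * L) → X) : Prop := L ≤ #{i | y i ∈ S (v x)}
  have hle : ∑ x, #{y | P x y} ≤ #{z | z ∈ badSamples S (2 * k * L) L} := by
    have : ∑ x, #{y | P x y} = #{q : (Fin (2 * k * L) → X) × (Fin (2 * k * L) → X) | P q.1 q.2} := by
      rw [← univ_product_univ, Finset.card_filter, Finset.sum_product]
      simp only [Finset.card_filter]
    rw [this]
    refine card_le_card_of_injOn (fun q j => if j.2 then q.2 j.1 else q.1 j.1) ?_ ?_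
    · intro q hq
      simp only [Finset.coe_filter, Finset.mem_univ, true_and, Set.mem_ofPred_eq] at hq ⊢
      refine ⟨v q.1, by simpa using hv q.1, ?_⟩
      rw [Set.ncard_eq_toFinset_card']
      simpa [P] using hq
    · intro q _ q' _ hqq
      exact Prod.ext (funext fun i => by simpa using congr_fun hqq (i, false))
        (funext fun i => by simpa using congr_fun hqq (i, true))
  calc Fintype.card X ^ (2 * k * L) * Fintype.card X ^ (2 * k * L)
      = ∑ x : Fin (2 * k * L) → X, Fintype.card X ^ (2 * k * L) := by simp
    _ ≤ ∑ x : Fin (2 * k * L) → X, 2 * k * #{y | P x y} :=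
        sum_le_sum fun x _ => card_pow_le_mul_card_hits (· ∈ S (v x)) hk hL (h _)
    _ ≤ _ := by rw [← mul_sum]; gcongr

open Classical Finset in
/-- The **ε-net theorem** for grid-free families, by double sampling. -/
theorem GridFree.exists_net {V X : Type*} [Fintype V] [Fintype X] [Nonempty X] {S : V → Set X}
    (hS : GridFree S) {k L : ℕ} (hk : 0 < k) (hL : 0 < L)
    (hkL : 32 * k * (4 * k * L) ^ 15 < 2 ^ L) (h : ∀ v, Fintype.card X ≤ k * #{x | x ∈ S v}) :
    ∃ x : Fin (2 * k * L) → X, ∀ v, ∃ i, x i ∈ S v := by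
  by_contra! hno
  have hlow := pow_mul_pow_le_mul_card_badSamples hk hL h hno
  have hup := hS.card_badSamples_mul_le (m := 2 * k * L) (by positivity) L
  set B := #{z | z ∈ badSamples S (2 * k * L) L}
  set c := Fintype.card X ^ (2 * k * L) * Fintype.card X ^ (2 * k * L)
  have hpos : 0 < c := by
    have : 0 < Fintype.card X := Fintype.card_pos
    positivity
  have : c * 2 ^ L ≤ c * (32 * k * (4 * k * L) ^ 15) := by
    calc c * 2 ^ L ≤ 2 * k * B * 2 ^ L := by gcongr
      _ = 2 * k * (B * 2 ^ L) := by ring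
      _ ≤ 2 * k * (16 * (2 * (2 * k * L)) ^ 15 * c) := by gcongr
      _ = _ := by rw [show 2 * (2 * k * L) = 4 * k * L by ring]; ring
  exact absurd (Nat.le_of_mul_le_mul_left this hpos) (by omega)

open Classical Finset in
/-- Transversals of grid-free families whose members are nonempty and at most `n` of which can be
pairwise disjoint. -/
theorem GridFree.exists_transversal {V P : Type*} [Fintype V] [Nonempty V] {S : V → Set P}
    (hS : GridFree S) {n : ℕ}
    (hn : ∀ M : Finset V, (∀ y ∈ M, ∀ z ∈ M, y ≠ z → Disjoint (S y) (S z)) → #M ≤ n)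
    (hne : ∀ v, (S v).Nonempty) :
    ∃ x : Fin (2 ^ 11 * 640000 * n ^ 5) → P, ∀ v, ∃ i, x i ∈ S v := by
  have hnpos : 0 < n := Nat.lt_of_lt_of_le (by simp) (hn {Classical.arbitrary V} (by simp))
  obtain ⟨t, ht, x, hx⟩ := exists_uniform_hitting (K := 160000 * n ^ 4) (by positivity)
    (hS.exists_sum_le_mul hn hne)
  have : Nonempty (Fin t) := ⟨⟨0, ht⟩⟩
  have hkL : 32 * (640000 * n ^ 4) * (4 * (640000 * n ^ 4) * (1024 * n)) ^ 15 <
      2 ^ (1024 * n) := by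
    have h2 : n ≤ 2 ^ n := Nat.lt_two_pow_self.le
    calc 32 * (640000 * n ^ 4) * (4 * (640000 * n ^ 4) * (1024 * n)) ^ 15
        ≤ 2 ^ 5 * (2 ^ 20 * (2 ^ n) ^ 4) *
          (2 ^ 2 * (2 ^ 20 * (2 ^ n) ^ 4) * (2 ^ 10 * 2 ^ n)) ^ 15 := by
          gcongr <;> norm_num
      _ = 2 ^ (505 + 79 * n) := by
          simp only [← pow_mul, ← pow_add]
          congr 1
          ring
      _ < 2 ^ (1024 * n) := by
          gcongr
          · norm_num
          · omega
  obtain ⟨y, hy⟩ := (hS.preimage x).exists_net (k := 640000 * n ^ 4) (L := 1024 * n)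
    (by positivity) (by positivity) hkL (fun v => by
      have := hx v
      rw [Fintype.card_fin]
      calc t ≤ 4 * (160000 * n ^ 4) * #{s | x s ∈ S v} := this
        _ = 640000 * n ^ 4 * #{s | x s ∈ S v} := by ring
        _ = _ := rfl)
  exact ⟨fun i => x (y (i.cast (by ring))), fun v => by
    obtain ⟨i, hi⟩ := hy v
    exact ⟨i.cast (by ring), hi⟩⟩

theorem gridFree_of_nonPiercing {ℱ : Set (Set Plane)} (hreg : ∀ F ∈ ℱ, IsRegion F)
    (hnp : NonPiercing ℱ) : GridFree fun F : ℱ => (F : Set Plane) := by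
  rintro ⟨a, b, p, hp⟩
  let e : Plane ≃ₜ ℂ := Complex.equivRealProdCLM.symm.toHomeomorph
  let F : Fin 3 ⊕ Fin 3 → ℱ := Sum.elim (fun i => a i.castSucc) (fun j => b j.castSucc)
  let v : Fin 3 ⊕ Fin 3 → Plane :=
    Sum.elim (fun i => p i.castSucc (Fin.last 3)) (fun j => p (Fin.last 3) j.castSucc)
  have hv (s t) : v s ∈ (F t : Set Plane) ↔ t = s := by
    have h3 (i : Fin 3) : i.castSucc ≠ 3 := i.castSucc_lt_last.ne
    rcases s with s | s <;> rcases t with t | t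
    · simpa [v, F] using (hp s.castSucc (Fin.last 3) t.castSucc).1
    · simpa [v, F, h3] using (hp s.castSucc (Fin.last 3) t.castSucc).2
    · simpa [v, F, h3] using (hp (Fin.last 3) s.castSucc t.castSucc).1
    · simpa [v, F] using (hp (Fin.last 3) s.castSucc t.castSucc).2
  refine not_exists_depth_two_k33 (fun s => e '' F s) (fun s => ?_) (fun s => ?_)
    (fun s t hst => ?_) (fun s => e (v s)) (fun s t => ?_)
    (fun i j => e (p i.castSucc j.castSucc)) (fun i j t => ?_)
  · exact ((hreg _ (F s).2).1.image e.continuous).isClosed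
  · exact (hreg _ (F s).2).2.1.isPreconnected.image _ e.continuous.continuousOn
  · rw [← image_sdiff e.injective]
    refine (hnp _ (F s).2 _ (F t).2 fun h => hst ?_).isPreconnected.image _
      e.continuous.continuousOn
    rw [← hv t s, h, hv]
  · rw [e.injective.mem_set_image, hv]
  · rw [e.injective.mem_set_image]
    rcases t with t | t
    · simpa [F] using (hp i.castSucc j.castSucc t.castSucc).1
    · simpa [F] using (hp i.castSucc j.castSucc t.castSucc).2

theorem card_le_matchingNumber {ℱ : Set (Set Plane)} (hfin : ℱ.Finite)
    {𝒢 : Finset (Set Plane)} (h𝒢 : ↑𝒢 ⊆ ℱ) (hdisj : (𝒢 : Set (Set Plane)).Pairwise Disjoint) :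
    𝒢.card ≤ matchingNumber ℱ := by
  refine le_csSup ⟨ℱ.ncard, ?_⟩ ⟨𝒢, h𝒢, rfl, hdisj⟩
  rintro n ⟨ℋ, hℋ, rfl, -⟩
  rw [← Set.ncard_coe_finset]
  exact Set.ncard_le_ncard hℋ hfin

theorem transversalNumber_le {ℱ : Set (Set Plane)} {m : ℕ} (x : Fin m → Plane)
    (hx : ∀ F ∈ ℱ, ∃ i, x i ∈ F) : transversalNumber ℱ ≤ m := by
  classical
  have h : transversalNumber ℱ ≤ (Finset.univ.image x).card :=
    Nat.sInf_le ⟨Finset.univ.image x, rfl, fun F hF => by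
      obtain ⟨i, hi⟩ := hx F hF
      exact ⟨x i, Finset.mem_image_of_mem _ (Finset.mem_univ i), hi⟩⟩
  exact h.trans (Finset.card_image_le.trans (by simp))

/-- There exists a constant `C > 0` such that every finite non-piercing family `ℱ` of
regions in general position satisfies `τ(ℱ) ≤ C · ν(ℱ)^9`. -/
theorem transversal_le_const_mul_matching_pow_nine :
    ∃ C : ℝ, 0 < C ∧ ∀ ℱ : Set (Set Plane), ℱ.Finite →
      (∀ F ∈ ℱ, IsRegion F) → GeneralPosition ℱ → NonPiercing ℱ →
      (transversalNumber ℱ : ℝ) ≤ C * (matchingNumber ℱ : ℝ) ^ 9 := by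
  refine ⟨2 ^ 11 * 640000, by positivity, fun ℱ hfin hreg _ hnp => ?_⟩
  rcases ℱ.eq_empty_or_nonempty with rfl | ⟨F₀, hF₀⟩
  · have : transversalNumber ∅ ≤ 0 := transversalNumber_le (m := 0) Fin.elim0 (by simp)
    rw [Nat.le_zero.1 this, Nat.cast_zero]
    positivity
  have : Fintype ℱ := hfin.fintype
  have : Nonempty ℱ := ⟨⟨F₀, hF₀⟩⟩
  have hpos : 1 ≤ matchingNumber ℱ :=
    card_le_matchingNumber hfin (𝒢 := {F₀}) (by simpa using hF₀) (by simp)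
  obtain ⟨x, hx⟩ := (gridFree_of_nonPiercing hreg hnp).exists_transversal (n := matchingNumber ℱ)
    (fun M hM => by
      rw [← Finset.card_map (Function.Embedding.subtype (· ∈ ℱ))]
      refine card_le_matchingNumber hfin (by intro F hF; simp at hF; exact hF.1) ?_
      intro F hF G hG hFG
      obtain ⟨F, hFM, rfl⟩ := Finset.mem_map.1 hF
      obtain ⟨G, hGM, rfl⟩ := Finset.mem_map.1 hG
      exact hM F hFM G hGM fun h => hFG (h ▸ rfl))
    (fun F => (hreg F F.2).2.1.nonempty)
  have hle := transversalNumber_le x fun F hF => hx ⟨F, hF⟩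
  calc (transversalNumber ℱ : ℝ) ≤ 2 ^ 11 * 640000 * (matchingNumber ℱ : ℝ) ^ 5 := by
        exact_mod_cast hle
    _ ≤ 2 ^ 11 * 640000 * (matchingNumber ℱ : ℝ) ^ 9 := by
        have : (1 : ℝ) ≤ matchingNumber ℱ := by exact_mod_cast hpos
        gcongr
        norm_num
end

section
/- For every non-piercing family ℱ of regions in the plane in general position, the dyadic dual VC-dimension satisfies λ(ℱ) ≤ 4; that is, there do not exist five sets F₁, F₂, F₃, F₄, F₅ ∈ ℱ together with points a_{i,j} for all 1 ≤ i < j ≤ 5 such that a_{i,j} ∈ F_i ∩ F_j and a_{i,j} ∉ F_k for every k ∈ {1,…,5} \ {i,j}. -/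
open Set

namespace PlaneTopology

open Complex Topology Filter Metric

/-! ### Increments of continuous logarithms -/

theorem exists_continuous_log {X : Type*} [TopologicalSpace X] [SimplyConnectedSpace X]
    [LocallyPathConnectedSpace X] {f : X → ℂ} (hf : Continuous f) (h0 : ∀ x, f x ≠ 0) :
    ∃ g : X → ℂ, Continuous g ∧ ∀ x, exp (g x) = f x := by
  obtain ⟨x₀⟩ : Nonempty X := inferInstance
  obtain ⟨g, ⟨-, hg⟩, -⟩ := isCoveringMapOn_exp.existsUnique_continuousMap_lifts
    (⟨f, hf⟩ : C(X, ℂ)) (exp_log (h0 x₀)) h0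
  exact ⟨g, g.continuous, fun x ↦ congrFun hg x⟩

theorem sub_eq_sub_of_exp_eq {X : Type*} [TopologicalSpace X] [SimplyConnectedSpace X]
    [LocallyPathConnectedSpace X] {g h : X → ℂ} (hg : Continuous g) (hh : Continuous h)
    (hgh : ∀ x, exp (g x) = exp (h x)) (x y : X) : g x - g y = h x - h y := by
  obtain ⟨F, -, hF⟩ := isCoveringMapOn_exp.existsUnique_continuousMap_lifts
    (⟨fun x ↦ exp (h x), by fun_prop⟩ : C(X, ℂ)) (a₀ := y) (e₀ := h y) rfl
    (fun x ↦ exp_ne_zero _)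
  have h₁ := hF ⟨h, hh⟩ ⟨rfl, rfl⟩
  have h₂ := hF ⟨fun x ↦ g x + (h y - g y), by fun_prop⟩
    ⟨by simp, by
      funext x
      have : exp (h y - g y) = 1 := by rw [exp_sub, hgh, div_self (exp_ne_zero _)]
      simp [exp_add, hgh, this]⟩
  have := congrArg (fun F : C(X, ℂ) ↦ F x) (h₁.trans h₂.symm)
  simp only [ContinuousMap.coe_mk] at this
  linear_combination -this

open Classical in
/-- The increment over `[0, 1]` of a continuous logarithm of `f` (zero if there is none). -/
noncomputable def logIncrement (f : ℝ → ℂ) : ℂ :=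
  if h : ∃ g : ℝ → ℂ, Continuous g ∧ ∀ t, exp (g t) = f t then h.choose 1 - h.choose 0 else 0

theorem logIncrement_eq {f g : ℝ → ℂ} (hg : Continuous g) (hgf : ∀ t, exp (g t) = f t) :
    logIncrement f = g 1 - g 0 := by
  have h : ∃ g : ℝ → ℂ, Continuous g ∧ ∀ t, exp (g t) = f t := ⟨g, hg, hgf⟩
  rw [logIncrement, dif_pos h]
  exact sub_eq_sub_of_exp_eq h.choose_spec.1 hg
    (fun t ↦ (h.choose_spec.2 t).trans (hgf t).symm) 1 0

theorem exp_logIncrement {f : ℝ → ℂ} (hf : Continuous f) (h0 : ∀ t, f t ≠ 0) :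
    exp (logIncrement f) = f 1 / f 0 := by
  obtain ⟨g, hg, hgf⟩ := exists_continuous_log hf h0
  rw [logIncrement_eq hg hgf, exp_sub, hgf, hgf]

theorem logIncrement_neg {f : ℝ → ℂ} (hf : Continuous f) (h0 : ∀ t, f t ≠ 0) :
    logIncrement (fun t ↦ -f t) = logIncrement f := by
  obtain ⟨g, hg, hgf⟩ := exists_continuous_log hf h0
  rw [logIncrement_eq hg hgf, logIncrement_eq (g := fun t ↦ g t + Real.pi * I) (by fun_prop)
    (by simp [exp_add, hgf])]
  ring

theorem logIncrement_rectangle {H : ℝ × ℝ → ℂ} (hH : Continuous H) (h0 : ∀ p, H p ≠ 0) :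
    logIncrement (fun t ↦ H (0, t)) + logIncrement (fun s ↦ H (s, 1)) =
      logIncrement (fun s ↦ H (s, 0)) + logIncrement (fun t ↦ H (1, t)) := by
  obtain ⟨g, hg, hgf⟩ := exists_continuous_log hH h0
  rw [logIncrement_eq (g := fun t ↦ g (0, t)) (by fun_prop) (fun _ ↦ hgf _),
    logIncrement_eq (g := fun s ↦ g (s, 1)) (by fun_prop) (fun _ ↦ hgf _),
    logIncrement_eq (g := fun s ↦ g (s, 0)) (by fun_prop) (fun _ ↦ hgf _),
    logIncrement_eq (g := fun t ↦ g (1, t)) (by fun_prop) (fun _ ↦ hgf _)]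
  ring

/-- `I` times the angle swept by the curve `P` seen from `x`, plus the change of `log |P - x|`. -/
noncomputable def sweep (x : ℂ) (P : ℝ → ℂ) : ℂ := logIncrement fun t ↦ P t - x

theorem sweep_add_sweep_of_disjoint {P Q : ℝ → ℂ} (hP : Continuous P) (hQ : Continuous Q)
    (h : ∀ s t, P s ≠ Q t) :
    sweep (P 0) Q + sweep (Q 1) P = sweep (Q 0) P + sweep (P 1) Q := by
  have key := logIncrement_rectangle (H := fun p ↦ P p.1 - Q p.2) (by fun_prop)
    (fun p ↦ sub_ne_zero.2 (h _ _))
  have hneg (s : ℝ) : logIncrement (fun t ↦ P s - Q t) = sweep (P s) Q := by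
    rw [sweep, ← logIncrement_neg (by fun_prop) fun t ↦ sub_ne_zero.2 (h s t).symm]
    simp only [neg_sub]
  simp only [hneg] at key
  exact key

/-! ### Curves near compact sets -/

theorem exists_curve_of_isPreconnected {S U : Set ℂ} (hS : IsPreconnected S) (hU : IsOpen U)
    (hSU : S ⊆ U) {x y : ℂ} (hx : x ∈ S) (hy : y ∈ S) :
    ∃ P : ℝ → ℂ, Continuous P ∧ P 0 = x ∧ P 1 = y ∧ (∀ t, P t ∈ U) ∧ IsCompact (range P) := by
  have hc : IsConnected (connectedComponentIn U x) :=
    isConnected_connectedComponentIn_iff.2 (hSU hx)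
  have hsub := hS.subset_connectedComponentIn hx hSU
  obtain ⟨γ, hγ⟩ := (hU.connectedComponentIn.isConnected_iff_isPathConnected.1 hc).joinedIn
    x (hsub hx) y (hsub hy)
  refine ⟨γ.extend, γ.continuous_extend, γ.extend_zero, γ.extend_one, fun t ↦ ?_, ?_⟩
  · obtain ⟨s, hs⟩ : γ.extend t ∈ range γ := γ.extend_range ▸ mem_range_self t
    exact hs ▸ connectedComponentIn_subset U x (hγ s)
  · rw [γ.extend_range]
    exact isCompact_range γ.continuous

/-- Curves in thin neighbourhoods of two sets `F` and `G` with connected differences, whose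
endpoints `a, b ∈ F \ G` and `c, d ∈ G \ F` avoid the other set, have crossing number zero.
The curve from `a` to `b` is given as the difference of `P₂` and `P₁`, which share their starting
point, and likewise for the curve from `c` to `d`. -/
theorem eventually_sweep_eq_zero {F G : Set ℂ} (hF : IsCompact F) (hG : IsCompact G)
    (hFG : IsPreconnected (F \ G)) (hGF : IsPreconnected (G \ F)) {a b c d : ℂ}
    (ha : a ∈ F \ G) (hb : b ∈ F \ G) (hc : c ∈ G \ F) (hd : d ∈ G \ F) :
    ∀ᶠ δ in 𝓝[>] (0 : ℝ), ∀ P₁ P₂ Q₁ Q₂ : ℝ → ℂ,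
      Continuous P₁ → Continuous P₂ → Continuous Q₁ → Continuous Q₂ →
      (∀ t, P₁ t ∈ thickening δ F) → (∀ t, P₂ t ∈ thickening δ F) →
      (∀ t, Q₁ t ∈ thickening δ G) → (∀ t, Q₂ t ∈ thickening δ G) →
      P₁ 0 = P₂ 0 → Q₁ 0 = Q₂ 0 → P₁ 1 = a → P₂ 1 = b → Q₁ 1 = c → Q₂ 1 = d →
      sweep c P₂ - sweep c P₁ - sweep d P₂ + sweep d P₁
        + sweep b Q₂ - sweep b Q₁ - sweep a Q₂ + sweep a Q₁ = 0 := by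
  obtain ⟨Q, hQ, hQ0, hQ1, hQF, hQc⟩ := exists_curve_of_isPreconnected hGF
    hF.isClosed.isOpen_compl (fun x hx ↦ hx.2) hc hd
  obtain ⟨ε, hε, hεQ⟩ := hF.exists_thickening_subset_open hQc.isClosed.isOpen_compl
    (fun x hx ⟨t, ht⟩ ↦ hQF t (ht ▸ hx))
  obtain ⟨P, hP, hP0, hP1, hPU, hPc⟩ := exists_curve_of_isPreconnected hFG
    (isOpen_thickening.inter hG.isClosed.isOpen_compl)
    (fun x hx ↦ ⟨self_subset_thickening hε F hx.1, hx.2⟩) ha hb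
  obtain ⟨η, hη, hηP⟩ := hG.exists_thickening_subset_open hPc.isClosed.isOpen_compl
    (fun x hx ⟨t, ht⟩ ↦ (hPU t).2 (ht ▸ hx))
  filter_upwards [Ioo_mem_nhdsGT hε, Ioo_mem_nhdsGT hη] with δ hδε hδη
  intro P₁ P₂ Q₁ Q₂ hP₁ hP₂ hQ₁ hQ₂ hP₁F hP₂F hQ₁G hQ₂G hPP hQQ hP₁1 hP₂1 hQ₁1 hQ₂1
  have avoidQ {x : ℂ} (hx : x ∈ thickening ε F) (t : ℝ) : x ≠ Q t :=
    fun h ↦ hεQ hx ⟨t, h.symm⟩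
  have avoidP {x : ℂ} (hx : x ∈ thickening δ G) (t : ℝ) : P t ≠ x :=
    fun h ↦ hηP (thickening_mono hδη.2.le G hx) ⟨t, h⟩
  have e₁ := sweep_add_sweep_of_disjoint hP₁ hQ
    fun s ↦ avoidQ (thickening_mono hδε.2.le F (hP₁F s))
  have e₂ := sweep_add_sweep_of_disjoint hP₂ hQ
    fun s ↦ avoidQ (thickening_mono hδε.2.le F (hP₂F s))
  have e₃ := sweep_add_sweep_of_disjoint hP hQ fun s ↦ avoidQ (hPU s).1
  have e₄ := sweep_add_sweep_of_disjoint hP hQ₁ fun s t ↦ avoidP (hQ₁G t) s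
  have e₅ := sweep_add_sweep_of_disjoint hP hQ₂ fun s t ↦ avoidP (hQ₂G t) s
  rw [hP₁1, hQ0, hQ1, hPP] at e₁
  rw [hP₂1, hQ0, hQ1] at e₂
  rw [hP0, hP1, hQ0, hQ1] at e₃
  rw [hP0, hP1, hQ₁1, hQQ] at e₄
  rw [hP0, hP1, hQ₂1] at e₅
  linear_combination e₁ - e₂ + e₃ + e₄ - e₅

/-! ### The parity obstruction for the complete graph on five vertices -/

theorem exists_log_sub_comm (x y : ℂ) :
    ∃ m : ℤ, x ≠ y → log (y - x) = log (x - y) + Real.pi * I * (2 * m + 1) := by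
  by_cases h : x = y
  · exact ⟨0, fun h' ↦ absurd h h'⟩
  have : exp (log (y - x)) = exp (log (x - y) + Real.pi * I) := by
    rw [exp_add, exp_log (sub_ne_zero.2 (Ne.symm h)), exp_log (sub_ne_zero.2 h), exp_pi_mul_I]
    ring
  obtain ⟨m, hm⟩ := exp_eq_exp_iff_exists_int.1 this
  exact ⟨m, fun _ ↦ by linear_combination hm⟩

theorem exists_sweep_eq {x : ℂ} {P : ℝ → ℂ} (hP : Continuous P) (h : ∀ t, P t ≠ x) :
    ∃ n : ℤ, sweep x P = log (P 1 - x) - log (P 0 - x) + n * (2 * Real.pi * I) := by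
  refine exp_eq_exp_iff_exists_int.1 ?_
  rw [sweep, exp_logIncrement (by fun_prop) fun t ↦ sub_ne_zero.2 (h t), exp_sub,
    exp_log (sub_ne_zero.2 (h 1)), exp_log (sub_ne_zero.2 (h 0))]

theorem crossing_parity {α : Type*} (b : Fin 5 → Fin 5 → α) (hb : ∀ i j, b i j = b j i)
    (m : α → α → ℤ) (n : α → Fin 5 → Fin 5 → ℤ)
    (hm : ∀ i j k l, i ≠ k → i ≠ l → j ≠ k → j ≠ l → i ≠ j → k ≠ l →
      m (b k l) (b i j) = -1 - m (b i j) (b k l))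
    (h : ∀ i k j j' l l', i ≠ k → j ≠ i → j ≠ k → j' ≠ i → j' ≠ k → l ≠ i → l ≠ k →
      l' ≠ i → l' ≠ k →
      n (b k l) i j' - n (b k l) i j - n (b k l') i j' + n (b k l') i j
        + n (b i j') k l' - n (b i j') k l - n (b i j) k l' + n (b i j) k l
        + m (b i j') (b k l') - m (b i j') (b k l) - m (b i j) (b k l') + m (b i j) (b k l) = 0) :
    False := by
  have key (i k r j l : Fin 5) (hd : [i, k, r, j, l].Nodup) := And.intro
    (h i k r j r l (by grind) (by grind) (by grind) (by grind) (by grind) (by grind) (by grind)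
      (by grind) (by grind))
    (h i k r l r j (by grind) (by grind) (by grind) (by grind) (by grind) (by grind) (by grind)
      (by grind) (by grind))
  have k01 := key 0 1 2 3 4 (by decide)
  have k02 := key 0 2 1 3 4 (by decide)
  have k03 := key 0 3 1 2 4 (by decide)
  have k04 := key 0 4 1 2 3 (by decide)
  have k12 := key 1 2 0 3 4 (by decide)
  have k13 := key 1 3 0 2 4 (by decide)
  have k14 := key 1 4 0 2 3 (by decide)
  have k23 := key 2 3 0 1 4 (by decide)
  have k24 := key 2 4 0 1 3 (by decide)
  have k34 := key 3 4 0 1 2 (by decide)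
  have hm' (i j k l : Fin 5) (hd : [i, j, k, l].Nodup) :=
    hm i j k l (by grind) (by grind) (by grind) (by grind) (by grind) (by grind)
  simp only [hb 1 0, hb 2 0, hb 3 0, hb 4 0, hb 2 1, hb 3 1, hb 4 1, hb 3 2, hb 4 2, hb 4 3]
    at k01 k02 k03 k04 k12 k13 k14 k23 k24 k34
  have m₁ := hm' 0 2 1 3 (by decide)
  have m₂ := hm' 0 2 1 4 (by decide)
  have m₃ := hm' 0 3 1 2 (by decide)
  have m₄ := hm' 0 3 1 4 (by decide)
  have m₅ := hm' 0 3 2 4 (by decide)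
  have m₆ := hm' 0 4 1 2 (by decide)
  have m₇ := hm' 0 4 1 3 (by decide)
  have m₈ := hm' 0 4 2 3 (by decide)
  have m₉ := hm' 1 3 2 4 (by decide)
  have m₁₀ := hm' 1 4 2 3 (by decide)
  simp only [m₁, m₂, m₃, m₄, m₅, m₆, m₇, m₈, m₉, m₁₀] at k01 k02 k03 k04 k12 k13 k14 k23 k24 k34
  have hsum (x₁ y₁ x₂ y₂ x₃ y₃ x₄ y₄ x₅ y₅ x₆ y₆ x₇ y₇ x₈ y₈ x₉ y₉ x₁₀ y₁₀ : ℤ)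
      (h₁ : x₁ = 0 ∧ y₁ = 0) (h₂ : x₂ = 0 ∧ y₂ = 0) (h₃ : x₃ = 0 ∧ y₃ = 0)
      (h₄ : x₄ = 0 ∧ y₄ = 0) (h₅ : x₅ = 0 ∧ y₅ = 0) (h₆ : x₆ = 0 ∧ y₆ = 0)
      (h₇ : x₇ = 0 ∧ y₇ = 0) (h₈ : x₈ = 0 ∧ y₈ = 0) (h₉ : x₉ = 0 ∧ y₉ = 0)
      (h₁₀ : x₁₀ = 0 ∧ y₁₀ = 0) : x₁ + y₁ + x₂ + y₂ + x₃ + y₃ + x₄ + y₄ + x₅ + y₅ + x₆ + y₆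
        + x₇ + y₇ + x₈ + y₈ + x₉ + y₉ + x₁₀ + y₁₀ = 0 := by omega
  have := hsum _ _ _ _ _ _ _ _ _ _ _ _ _ _ _ _ _ _ _ _ k01 k02 k03 k04 k12 k13 k14 k23 k24 k34
  clear hsum k01 k02 k03 k04 k12 k13 k14 k23 k24 k34 m₁ m₂ m₃ m₄ m₅ m₆ m₇ m₈ m₉ m₁₀
  omega

theorem not_exists_dyadic_points {F : Fin 5 → Set ℂ} (hF : ∀ i, IsCompact (F i))
    (hconn : ∀ i, IsPreconnected (F i))
    (hdiff : ∀ i j, i ≠ j → IsPreconnected (F i \ F j)) (b : Fin 5 → Fin 5 → ℂ)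
    (hb : ∀ i j, b i j = b j i) (hmem : ∀ i j, i ≠ j → b i j ∈ F i)
    (hnot : ∀ i j k, i ≠ j → k ≠ i → k ≠ j → b i j ∉ F k) : False := by
  have hstar : ∀ᶠ δ in 𝓝[>] (0 : ℝ), ∀ i k j j' l l' : Fin 5, i ≠ k → j ≠ i → j ≠ k → j' ≠ i →
      j' ≠ k → l ≠ i → l ≠ k → l' ≠ i → l' ≠ k → ∀ P₁ P₂ Q₁ Q₂ : ℝ → ℂ,
      Continuous P₁ → Continuous P₂ → Continuous Q₁ → Continuous Q₂ →
      (∀ t, P₁ t ∈ thickening δ (F i)) → (∀ t, P₂ t ∈ thickening δ (F i)) →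
      (∀ t, Q₁ t ∈ thickening δ (F k)) → (∀ t, Q₂ t ∈ thickening δ (F k)) →
      P₁ 0 = P₂ 0 → Q₁ 0 = Q₂ 0 → P₁ 1 = b i j → P₂ 1 = b i j' → Q₁ 1 = b k l → Q₂ 1 = b k l' →
      sweep (b k l) P₂ - sweep (b k l) P₁ - sweep (b k l') P₂ + sweep (b k l') P₁
        + sweep (b i j') Q₂ - sweep (b i j') Q₁ - sweep (b i j) Q₂ + sweep (b i j) Q₁ = 0 := by
    simp only [eventually_all]
    intro i k j j' l l' hik hji hjk hj'i hj'k hli hlk hl'i hl'k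
    exact eventually_sweep_eq_zero (hF i) (hF k) (hdiff i k hik) (hdiff k i hik.symm)
      ⟨hmem i j hji.symm, hnot i j k hji.symm hik.symm hjk.symm⟩
      ⟨hmem i j' hj'i.symm, hnot i j' k hj'i.symm hik.symm hj'k.symm⟩
      ⟨hmem k l hlk.symm, hnot k l i hlk.symm hik hli.symm⟩
      ⟨hmem k l' hl'k.symm, hnot k l' i hl'k.symm hik hl'i.symm⟩
  have havoid : ∀ᶠ δ in 𝓝[>] (0 : ℝ), ∀ i j k : Fin 5, i ≠ j → k ≠ i → k ≠ j →
      b i j ∉ thickening δ (F k) := by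
    simp only [eventually_all]
    intro i j k hij hki hkj
    obtain ⟨ε, hε, h⟩ := (hF k).exists_thickening_subset_open isOpen_compl_singleton
      (subset_compl_singleton_iff.2 (hnot i j k hij hki hkj))
    filter_upwards [Ioo_mem_nhdsGT hε] with δ hδ hmem
    exact h (thickening_mono hδ.2.le _ hmem) rfl
  obtain ⟨δ, hδ, havoid, hstar⟩ := (eventually_mem_nhdsWithin.and (havoid.and hstar)).exists
  have hP (i j : Fin 5) : ∃ P : ℝ → ℂ, i ≠ j → Continuous P ∧ P 0 = b i (i + 1) ∧ P 1 = b i j ∧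
      ∀ t, P t ∈ thickening δ (F i) := by
    by_cases hij : i = j
    · exact ⟨0, fun h ↦ absurd hij h⟩
    obtain ⟨P, hP, h0, h1, hU, -⟩ := exists_curve_of_isPreconnected (hconn i)
      isOpen_thickening (self_subset_thickening hδ _)
      (hmem i (i + 1) (by simp)) (hmem i j hij)
    exact ⟨P, fun _ ↦ ⟨hP, h0, h1, hU⟩⟩
  choose P hP using hP
  choose m hm using exists_log_sub_comm
  have hn (x : ℂ) (i j : Fin 5) : ∃ n : ℤ, i ≠ j → x ∉ thickening δ (F i) → sweep x (P i j) =
      log (b i j - x) - log (b i (i + 1) - x) + n * (2 * Real.pi * I) := by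
    by_cases h : i ≠ j ∧ x ∉ thickening δ (F i)
    · obtain ⟨hc, h0, h1, hU⟩ := hP i j h.1
      obtain ⟨n, hn⟩ := exists_sweep_eq hc (x := x) fun t ht ↦ h.2 (ht ▸ hU t)
      exact ⟨n, fun _ _ ↦ by rw [hn, h0, h1]⟩
    · exact ⟨0, fun h₁ h₂ ↦ absurd ⟨h₁, h₂⟩ h⟩
  choose n hn using hn
  have hne (i j k l : Fin 5) (hik : i ≠ k) (hil : i ≠ l) (hij : i ≠ j) (hkl : k ≠ l) :
      b i j ≠ b k l :=
    fun h ↦ hnot k l i hkl hik hil (h ▸ hmem i j hij)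
  have hpi : (2 * Real.pi * I : ℂ) ≠ 0 := two_pi_I_ne_zero
  have hmanti (x y : ℂ) (hxy : x ≠ y) : m y x = -1 - m x y := by
    have h₁ := hm x y hxy
    have h₂ := hm y x hxy.symm
    have : (2 * Real.pi * I) * ((m y x : ℂ) - (-1 - m x y)) = 0 := by linear_combination -h₁ - h₂
    exact_mod_cast sub_eq_zero.1 ((mul_eq_zero.1 this).resolve_left hpi)
  refine crossing_parity b hb m n (fun i j k l hik hil hjk hjl hij hkl ↦
    hmanti _ _ (hne i j k l hik hil hij hkl)) ?_
  intro i k j j' l l' hik hji hjk hj'i hj'k hli hlk hl'i hl'k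
  obtain ⟨cj, zj, oj, uj⟩ := hP i j hji.symm
  obtain ⟨cj', zj', oj', uj'⟩ := hP i j' hj'i.symm
  obtain ⟨cl, zl, ol, ul⟩ := hP k l hlk.symm
  obtain ⟨cl', zl', ol', ul'⟩ := hP k l' hl'k.symm
  have h := hstar i k j j' l l' hik hji hjk hj'i hj'k hli hlk hl'i hl'k _ _ _ _ cj cj' cl cl'
    uj uj' ul ul' (zj.trans zj'.symm) (zl.trans zl'.symm) oj oj' ol ol'
  have al := havoid k l i hlk.symm hik hli.symm
  have al' := havoid k l' i hl'k.symm hik hl'i.symm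
  have aj := havoid i j k hji.symm hik.symm hjk.symm
  have aj' := havoid i j' k hj'i.symm hik.symm hj'k.symm
  rw [hn _ i j' hj'i.symm al, hn _ i j hji.symm al, hn _ i j' hj'i.symm al', hn _ i j hji.symm al',
    hn _ k l' hl'k.symm aj', hn _ k l hlk.symm aj', hn _ k l' hl'k.symm aj,
    hn _ k l hlk.symm aj] at h
  have e₁ := hm _ _ (hne i j' k l' hik hl'i.symm hj'i.symm hl'k.symm)
  have e₂ := hm _ _ (hne i j' k l hik hli.symm hj'i.symm hlk.symm)
  have e₃ := hm _ _ (hne i j k l' hik hl'i.symm hji.symm hl'k.symm)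
  have e₄ := hm _ _ (hne i j k l hik hli.symm hji.symm hlk.symm)
  rw [e₁, e₂, e₃, e₄] at h
  have h' : (2 * Real.pi * I) * ((n (b k l) i j' - n (b k l) i j - n (b k l') i j' + n (b k l') i j
        + n (b i j') k l' - n (b i j') k l - n (b i j) k l' + n (b i j) k l
        + m (b i j') (b k l') - m (b i j') (b k l) - m (b i j) (b k l')
        + m (b i j) (b k l) : ℤ) : ℂ) = 0 := by
    push_cast
    linear_combination h
  exact_mod_cast (mul_eq_zero.1 h').resolve_left hpi

end PlaneTopology

/-- The dyadic dual VC-dimension of a non-piercing family of regions in general position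
is at most 4: there do not exist five members `F₁, …, F₅` together with points
`a i j ∈ Fᵢ ∩ Fⱼ` (for `i < j`) avoiding all the other three sets. -/
theorem dyadicDualVC_le_four_of_nonPiercing (ℱ : Set (Set Plane))
    (hreg : ∀ F ∈ ℱ, IsRegion F) (hgp : GeneralPosition ℱ) (hnp : NonPiercing ℱ) :
    ¬ ∃ (F : Fin 5 → Set Plane) (a : Fin 5 → Fin 5 → Plane),
        (∀ i, F i ∈ ℱ) ∧ ∀ i j : Fin 5, i < j →
          a i j ∈ F i ∧ a i j ∈ F j ∧ ∀ k : Fin 5, k ≠ i → k ≠ j → a i j ∉ F k := by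
  rintro ⟨F, a, hFℱ, ha⟩
  have hne (i j : Fin 5) (hij : i ≠ j) : F i ≠ F j := by
    obtain ⟨k, hki, hkj⟩ : ∃ k : Fin 5, k ≠ i ∧ k ≠ j := by revert i j; decide
    intro h
    rcases lt_or_gt_of_ne hki with hlt | hlt
    · obtain ⟨-, h₁, h₂⟩ := ha k i hlt
      exact h₂ j hkj.symm hij.symm (h ▸ h₁)
    · obtain ⟨h₁, -, h₂⟩ := ha i k hlt
      exact h₂ j hij.symm hkj.symm (h ▸ h₁)
  let e := Complex.equivRealProdCLM.symm
  have he : Function.Injective e := e.injective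
  have hb (i j : Fin 5) (hij : i ≠ j) : a (min i j) (max i j) ∈ F i ∧
      ∀ k, k ≠ i → k ≠ j → a (min i j) (max i j) ∉ F k := by
    rcases lt_or_gt_of_ne hij with hlt | hlt
    · rw [min_eq_left hlt.le, max_eq_right hlt.le]
      exact ⟨(ha i j hlt).1, (ha i j hlt).2.2⟩
    · rw [min_eq_right hlt.le, max_eq_left hlt.le]
      exact ⟨(ha j i hlt).2.1, fun k hki hkj ↦ (ha j i hlt).2.2 k hkj hki⟩
  refine PlaneTopology.not_exists_dyadic_points (F := fun i ↦ e '' F i)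
    (fun i ↦ (hreg _ (hFℱ i)).1.image e.continuous)
    (fun i ↦ (hreg _ (hFℱ i)).2.1.isPreconnected.image _ e.continuous.continuousOn)
    (fun i j hij ↦ ?_) (fun i j ↦ e (a (min i j) (max i j)))
    (fun i j ↦ by rw [min_comm, max_comm])
    (fun i j hij ↦ mem_image_of_mem e (hb i j hij).1)
    (fun i j k hij hki hkj ↦ he.mem_set_image.not.2 ((hb i j hij).2 k hki hkj))
  rw [← image_sdiff he]
  exact (hnp _ (hFℱ i) _ (hFℱ j) (hne i j hij)).isPreconnected.image _ e.continuous.continuousOn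
end

section
/- For every non-piercing family ℱ of regions in the plane in general position, the dyadic dual VC-dimension satisfies λ(ℱ) ≤ 5; that is, there do not exist six sets F₁,…,F₆ ∈ ℱ together with points a_{i,j} for all 1 ≤ i < j ≤ 6 such that a_{i,j} ∈ F_i ∩ F_j and a_{i,j} ∉ F_k for every k ∈ {1,…,6} \ {i,j}. -/
open Set

open Metric Filter Topology

theorem isCompact_segment (a b : ℂ) : IsCompact (segment ℝ a b) := by
  rw [segment_eq_image_lineMap]
  exact isCompact_Icc.image AffineMap.lineMap_continuous

/-- A polygonal path in the complex plane, given by its successive vertices. -/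
inductive PolygonalPath : ℂ → ℂ → Type
  | nil (x : ℂ) : PolygonalPath x x
  | cons (x : ℂ) {y z : ℂ} (e : PolygonalPath y z) : PolygonalPath x z

namespace PolygonalPath

/-- The set of points on a polygonal path. -/
def carrier : {x y : ℂ} → PolygonalPath x y → Set ℂ
  | _, _, nil x => {x}
  | _, _, cons (y := y) x e => segment ℝ x y ∪ e.carrier

/-- Concatenation of polygonal paths. -/
def append : {x y z : ℂ} → PolygonalPath x y → PolygonalPath y z → PolygonalPath x z
  | _, _, _, nil _, f => f
  | _, _, _, cons x e, f => cons x (e.append f)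

/-- The total variation of the argument around `p` along a polygonal path. -/
noncomputable def argChange (p : ℂ) : {x y : ℂ} → PolygonalPath x y → ℝ
  | _, _, nil _ => 0
  | _, _, cons (y := y) x e => Complex.arg ((y - p) / (x - p)) + e.argChange p

/-- `2π` times the algebraic crossing number of two polygonal paths. -/
noncomputable def crossing {x y z w : ℂ} (e : PolygonalPath x y) (f : PolygonalPath z w) : ℝ :=
  e.argChange z - e.argChange w + f.argChange y - f.argChange x

variable {x y z w u : ℂ}

theorem left_mem_carrier (e : PolygonalPath x y) : x ∈ e.carrier := by
  cases e with
  | nil => exact mem_singleton _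
  | cons => exact Or.inl (left_mem_segment ℝ _ _)

theorem right_mem_carrier (e : PolygonalPath x y) : y ∈ e.carrier := by
  induction e with
  | nil => exact mem_singleton _
  | cons _ _ ih => exact Or.inr ih

theorem isCompact_carrier (e : PolygonalPath x y) : IsCompact e.carrier := by
  induction e with
  | nil => exact isCompact_singleton
  | @cons x y z e ih =>
    exact (isCompact_segment x y).union ih

theorem carrier_append (e : PolygonalPath x y) (f : PolygonalPath y z) :
    (e.append f).carrier ⊆ e.carrier ∪ f.carrier := by
  induction e with
  | nil => exact subset_union_right
  | cons x e ih =>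
    simp only [append, carrier, union_assoc]
    exact union_subset_union_right _ (ih f)

theorem argChange_append (p : ℂ) (e : PolygonalPath x y) (f : PolygonalPath y z) :
    (e.append f).argChange p = e.argChange p + f.argChange p := by
  induction e with
  | nil => simp [append, argChange]
  | cons x e ih => simp [append, argChange, ih, add_assoc]

theorem crossing_append_left (e : PolygonalPath x y) (e' : PolygonalPath y u)
    (f : PolygonalPath z w) :
    (e.append e').crossing f = e.crossing f + e'.crossing f := by
  simp only [crossing, argChange_append]; ring

theorem crossing_append_right (e : PolygonalPath x y) (f : PolygonalPath z w)
    (f' : PolygonalPath w u) :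
    e.crossing (f.append f') = e.crossing f + e.crossing f' := by
  simp only [crossing, argChange_append]; ring

theorem crossing_eq_zero_of_closed (e : PolygonalPath x x) (f : PolygonalPath z z) :
    e.crossing f = 0 := by
  simp [crossing]

theorem coe_argChange {p : ℂ} (e : PolygonalPath x y) (hp : p ∉ e.carrier) :
    (e.argChange p : Real.Angle) = Complex.arg (y - p) - Complex.arg (x - p) := by
  induction e with
  | nil => simp [argChange]
  | @cons x y z e ih =>
    simp only [carrier, mem_union, not_or] at hp
    have hx : x - p ≠ 0 := fun h => hp.1 (sub_eq_zero.1 h ▸ left_mem_segment ℝ _ _)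
    have hy : y - p ≠ 0 := fun h => hp.1 (sub_eq_zero.1 h ▸ right_mem_segment ℝ _ _)
    rw [argChange, Real.Angle.coe_add, ih hp.2, Complex.arg_div_coe_angle hy hx]
    abel

theorem exists_argChange_eq {p : ℂ} (e : PolygonalPath x y) (hp : p ∉ e.carrier) {α β : ℝ}
    (hα : (α : Real.Angle) = Complex.arg (x - p)) (hβ : (β : Real.Angle) = Complex.arg (y - p)) :
    ∃ n : ℤ, e.argChange p = β - α + 2 * Real.pi * n := by
  have h := e.coe_argChange hp
  rw [← hα, ← hβ, ← Real.Angle.coe_sub, Real.Angle.angle_eq_iff_two_pi_dvd_sub] at h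
  obtain ⟨n, hn⟩ := h
  exact ⟨n, by linarith⟩

end PolygonalPath

theorem Complex.arg_div_eq_sub_of_re_pos {a b : ℂ} (ha : 0 < a.re) (hb : 0 < b.re) :
    arg (a / b) = arg a - arg b := by
  have ha0 : a ≠ 0 := by rintro rfl; simp at ha
  have hb0 : b ≠ 0 := by rintro rfl; simp at hb
  have ha' := abs_lt.1 (abs_arg_lt_pi_div_two_iff.2 (Or.inl ha))
  have hb' := abs_lt.1 (abs_arg_lt_pi_div_two_iff.2 (Or.inl hb))
  have h := arg_div_coe_angle ha0 hb0
  rw [← Real.Angle.coe_sub] at h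
  rw [← arg_coe_angle_toReal_eq_arg, h, Real.Angle.toReal_coe_eq_self_iff]
  constructor <;> linarith

/-- A compact convex set missing the origin can be rotated into the right half-plane. -/
theorem exists_re_mul_pos {K : Set ℂ} (hK : IsCompact K) (hc : Convex ℝ K) (h0 : (0 : ℂ) ∉ K) :
    ∃ c : ℂ, ∀ a ∈ K, 0 < (c * a).re := by
  obtain ⟨f, u, hu, hf⟩ := geometric_hahn_banach_point_closed hc hK.isClosed h0
  refine ⟨⟨f 1, -f Complex.I⟩, fun a ha => ?_⟩
  have h1 : f a = a.re * f 1 + a.im * f Complex.I := by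
    conv_lhs => rw [show a = a.re • (1 : ℂ) + a.im • Complex.I by
      apply Complex.ext <;> simp]
    simp only [map_add, map_smul, smul_eq_mul]
  have h2 := hf a ha
  rw [map_zero] at hu
  rw [Complex.mul_re]
  nlinarith

theorem crossing_segments_eq_zero {x y z w : ℂ}
    (h : Disjoint (segment ℝ x y) (segment ℝ z w)) :
    Complex.arg ((y - z) / (x - z)) - Complex.arg ((y - w) / (x - w))
      + Complex.arg ((w - y) / (z - y)) - Complex.arg ((w - x) / (z - x)) = 0 := by
  obtain ⟨c, hc⟩ := exists_re_mul_pos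
    (K := (fun q : ℂ × ℂ => q.1 - q.2) '' (segment ℝ x y ×ˢ segment ℝ z w))
    (((isCompact_segment x y).prod (isCompact_segment z w)).image (by fun_prop))
    (((convex_segment x y).prod (convex_segment z w)).is_linear_image
      (LinearMap.isLinear (LinearMap.fst ℝ ℂ ℂ - LinearMap.snd ℝ ℂ ℂ)))
    (by
      rintro ⟨q, ⟨h1, h2⟩, h3⟩
      exact h.le_bot ⟨h1, sub_eq_zero.1 h3 ▸ h2⟩)
  have hpos : ∀ a ∈ segment ℝ x y, ∀ b ∈ segment ℝ z w, 0 < (c * (a - b)).re :=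
    fun a ha b hb => hc _ ⟨(a, b), ⟨ha, hb⟩, rfl⟩
  have hx := left_mem_segment ℝ x y
  have hy := right_mem_segment ℝ x y
  have hz := left_mem_segment ℝ z w
  have hw := right_mem_segment ℝ z w
  have hc0 : c ≠ 0 := by
    rintro rfl
    simpa using hpos x hx z hz
  have key : ∀ a b : ℂ, 0 < (c * a).re → 0 < (c * b).re →
      Complex.arg (a / b) = Complex.arg (c * a) - Complex.arg (c * b) := fun a b ha hb => by
    rw [← Complex.arg_div_eq_sub_of_re_pos ha hb, mul_div_mul_left _ _ hc0]
  have hneg : ∀ a b d : ℂ, (a - b) / (d - b) = (b - a) / (b - d) := fun a b d => by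
    rw [← neg_sub b a, ← neg_sub b d, neg_div_neg_eq]
  rw [hneg w y z, hneg w x z, key _ _ (hpos y hy z hz) (hpos x hx z hz),
    key _ _ (hpos y hy w hw) (hpos x hx w hw), key _ _ (hpos y hy w hw) (hpos y hy z hz),
    key _ _ (hpos x hx w hw) (hpos x hx z hz)]
  ring

namespace PolygonalPath

variable {x y z w : ℂ}

theorem crossing_eq_zero_of_disjoint (e : PolygonalPath x y) (f : PolygonalPath z w)
    (h : Disjoint e.carrier f.carrier) : e.crossing f = 0 := by
  induction e with
  | nil => simp [crossing, argChange]
  | @cons x y _ e ih =>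
    simp only [carrier, disjoint_union_left] at h
    have hseg : ((nil y).cons x).crossing f = 0 := by
      clear ih
      induction f with
      | nil => simp [crossing, argChange]
      | @cons z w _ f ih' =>
        simp only [carrier, disjoint_union_right] at h
        have h1 := ih' ⟨h.1.2, h.2.2⟩
        have h2 := crossing_segments_eq_zero h.1.1
        simp only [crossing, argChange] at h1 ⊢
        linarith
    have := crossing_append_left ((nil y).cons x) e f
    rw [hseg, ih h.2, add_zero] at this
    exact this

end PolygonalPath

theorem IsPreconnected.exists_polygonalPath {S U : Set ℂ} (hS : IsPreconnected S) (hU : IsOpen U)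
    (hSU : S ⊆ U) {x y : ℂ} (hx : x ∈ S) (hy : y ∈ S) :
    ∃ e : PolygonalPath x y, e.carrier ⊆ U := by
  have key := hS.induction₂
    (fun x y => (∃ e : PolygonalPath x y, e.carrier ⊆ U) ∧ ∃ e : PolygonalPath y x, e.carrier ⊆ U)
    (fun x hx => ?_) (fun x y z _ _ _ ⟨⟨e, he⟩, e', he'⟩ ⟨⟨f, hf⟩, f', hf'⟩ =>
      ⟨⟨e.append f, (e.carrier_append f).trans (union_subset he hf)⟩,
        f'.append e', (f'.carrier_append e').trans (union_subset hf' he')⟩)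
    (fun _ _ _ _ h => ⟨h.2, h.1⟩) hx hy
  · exact key.1
  · obtain ⟨r, hr, hball⟩ := Metric.isOpen_iff.1 hU x (hSU hx)
    refine mem_nhdsWithin_of_mem_nhds (mem_of_superset (ball_mem_nhds x hr) fun y hy => ?_)
    have hx' := mem_ball_self (x := x) hr
    have hc := convex_ball x r
    exact ⟨⟨(PolygonalPath.nil y).cons x, union_subset ((hc.segment_subset hx' hy).trans hball)
        (singleton_subset_iff.2 (hball hy))⟩,
      (PolygonalPath.nil x).cons y, union_subset ((hc.segment_subset hy hx').trans hball)
        (singleton_subset_iff.2 (hball hx'))⟩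

theorem IsCompact.eventually_disjoint_thickening {X : Type*} [PseudoEMetricSpace X] {K F : Set X}
    (hK : IsCompact K) (hF : IsClosed F) (h : Disjoint K F) :
    ∀ᶠ η in 𝓝[>] (0 : ℝ), Disjoint K (thickening η F) := by
  obtain ⟨δ, hδ, hd⟩ := h.exists_thickenings hK hF
  filter_upwards [Ioo_mem_nhdsGT hδ] with η hη
  exact hd.mono (self_subset_thickening hδ K) (thickening_mono hη.2.le F)

/-- Paths running close to two non-piercing sets do not cross algebraically as soon as the
endpoints of each of them lie outside of the other set. -/
theorem eventually_crossing_eq_zero_s3 {F G : Set ℂ} (hF : IsClosed F) (hG : IsClosed G)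
    (hFG : IsPreconnected (F \ G)) (hGF : IsPreconnected (G \ F)) {x y z w : ℂ}
    (hx : x ∈ F \ G) (hy : y ∈ F \ G) (hz : z ∈ G \ F) (hw : w ∈ G \ F) :
    ∀ᶠ η in 𝓝[>] (0 : ℝ), ∀ (e : PolygonalPath x y) (f : PolygonalPath z w),
      e.carrier ⊆ thickening η F → f.carrier ⊆ thickening η G → e.crossing f = 0 := by
  obtain ⟨A, hA⟩ := hFG.exists_polygonalPath hG.isOpen_compl (fun _ h => h.2) hy hx
  obtain ⟨B, hB⟩ := hGF.exists_polygonalPath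
    (hF.isOpen_compl.inter A.isCompact_carrier.isClosed.isOpen_compl)
    (fun _ h => ⟨h.2, fun h' => hA h' h.1⟩) hw hz
  filter_upwards [A.isCompact_carrier.eventually_disjoint_thickening hG
      (subset_compl_iff_disjoint_right.1 hA),
    B.isCompact_carrier.eventually_disjoint_thickening hF
      (subset_compl_iff_disjoint_right.1 fun _ h => (hB h).1)] with η hAG hBF e f he hf
  have h1 : A.crossing f = 0 := A.crossing_eq_zero_of_disjoint f (hAG.mono_right hf)
  have h2 : A.crossing B = 0 := A.crossing_eq_zero_of_disjoint B
    (subset_compl_iff_disjoint_right.1 fun _ h => (hB h).2).symm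
  have h3 : e.crossing B = 0 := e.crossing_eq_zero_of_disjoint B (hBF.mono_right he).symm
  have h4 := (e.append A).crossing_eq_zero_of_closed (f.append B)
  rw [PolygonalPath.crossing_append_left, PolygonalPath.crossing_append_right,
    PolygonalPath.crossing_append_right, h1, h2, h3] at h4
  linarith

/-- In every drawing of `K₅` by polygonal paths some two independent edges have a nonzero
algebraic crossing number. -/
theorem exists_crossing_ne_zero (v : Fin 5 → ℂ)
    (E : ∀ i j, i < j → PolygonalPath (v i) (v j))
    (hE : ∀ i j (hij : i < j) k, k ≠ i → k ≠ j → v k ∉ (E i j hij).carrier) :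
    ∃ i j k l, ∃ (hij : i < j) (hkl : k < l), i ≠ k ∧ i ≠ l ∧ j ≠ k ∧ j ≠ l ∧
      (E i j hij).crossing (E k l hkl) ≠ 0 := by
  by_contra! hcr
  have hv : Pairwise fun i j => v i ≠ v j := by
    have hlt : ∀ i j, i < j → v i ≠ v j := by
      intro i j hij h
      obtain ⟨m, hmi, hmj⟩ : ∃ m : Fin 5, m ≠ i ∧ m ≠ j := by
        clear h hij
        revert i j
        decide
      rcases hmi.lt_or_gt with hm | hm
      · exact hE m i hm j hmj.symm hij.ne' (h ▸ (E m i hm).right_mem_carrier)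
      · exact hE i m hm j hij.ne' hmj.symm (h ▸ (E i m hm).left_mem_carrier)
    intro i j hij
    rcases hij.lt_or_gt with h | h
    · exact hlt i j h
    · exact (hlt j i h).symm
  let α : Fin 5 → Fin 5 → ℝ := fun k j =>
    if k < j then Complex.arg (v j - v k) else Complex.arg (v k - v j) + Real.pi
  have hα : ∀ k j, j ≠ k → (α k j : Real.Angle) = Complex.arg (v j - v k) := by
    intro k j hjk
    by_cases h : k < j
    · simp only [α, if_pos h]
    · simp only [α, if_neg h]
      rw [← neg_sub (v k) (v j), Complex.arg_neg_coe_angle (sub_ne_zero.2 (hv hjk.symm)),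
        Real.Angle.coe_add]
  have hαα : ∀ k j, k < j → α j k = α k j + Real.pi := fun k j h => by
    simp only [α, if_pos h, if_neg h.asymm]
  have hn : ∀ k i j, ∃ n : ℤ, ∀ hij : i < j, k ≠ i → k ≠ j →
      (E i j hij).argChange (v k) = α k j - α k i + 2 * Real.pi * n := by
    intro k i j
    by_cases h : i < j ∧ k ≠ i ∧ k ≠ j
    · obtain ⟨n, hn⟩ := (E i j h.1).exists_argChange_eq (hE i j h.1 k h.2.1 h.2.2)
        (hα k i h.2.1.symm) (hα k j h.2.2.symm)
      exact ⟨n, fun _ _ _ => hn⟩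
    · exact ⟨0, fun h1 h2 h3 => absurd ⟨h1, h2, h3⟩ h⟩
  choose n hn using hn
  have quad : ∀ i j k l : Fin 5, i < j → j < k → k < l →
      n k i j - n l i j + n j k l - n i k l = 0 ∧
      n j i k - n l i k + n k j l - n i j l = 1 ∧
      n j i l - n k i l + n l j k - n i j k = 0 := by
    intro i j k l hij hjk hkl
    have hik := hij.trans hjk
    have hjl := hjk.trans hkl
    have hil := hij.trans hjl
    have h1 := hcr i j k l hij hkl hik.ne hil.ne hjk.ne hjl.ne
    have h2 := hcr i k j l hik hjl hij.ne hil.ne hjk.ne' hkl.ne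
    have h3 := hcr i l j k hil hjk hij.ne hik.ne hjl.ne' hkl.ne'
    simp only [PolygonalPath.crossing] at h1 h2 h3
    rw [hn k i j hij hik.ne' hjk.ne', hn l i j hij hil.ne' hjl.ne', hn j k l hkl hjk.ne hjl.ne,
      hn i k l hkl hik.ne hil.ne] at h1
    rw [hn j i k hik hij.ne' hjk.ne, hn l i k hik hil.ne' hkl.ne', hn k j l hjl hjk.ne' hkl.ne,
      hn i j l hjl hij.ne hil.ne] at h2
    rw [hn j i l hil hij.ne' hjl.ne, hn k i l hil hik.ne' hkl.ne, hn l j k hjk hjl.ne' hkl.ne',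
      hn i j k hjk hij.ne hik.ne] at h3
    have e1 := hαα i j hij
    have e2 := hαα i k hik
    have e3 := hαα i l hil
    have e4 := hαα j k hjk
    have e5 := hαα j l hjl
    have e6 := hαα k l hkl
    have hpi : (2 * Real.pi) ≠ 0 := by positivity
    have c1 : 2 * Real.pi * (n k i j - n l i j + n j k l - n i k l : ℝ) = 2 * Real.pi * 0 := by
      linarith
    have c2 : 2 * Real.pi * (n j i k - n l i k + n k j l - n i j l : ℝ) = 2 * Real.pi * 1 := by
      linarith
    have c3 : 2 * Real.pi * (n j i l - n k i l + n l j k - n i j k : ℝ) = 2 * Real.pi * 0 := by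
      linarith
    exact ⟨by exact_mod_cast mul_left_cancel₀ hpi c1, by exact_mod_cast mul_left_cancel₀ hpi c2,
      by exact_mod_cast mul_left_cancel₀ hpi c3⟩
  have q0 := quad 1 2 3 4 (by decide) (by decide) (by decide)
  have q1 := quad 0 2 3 4 (by decide) (by decide) (by decide)
  have q2 := quad 0 1 3 4 (by decide) (by decide) (by decide)
  have q3 := quad 0 1 2 4 (by decide) (by decide) (by decide)
  have q4 := quad 0 1 2 3 (by decide) (by decide) (by decide)
  omega

/-- Five non-piercing closed connected sets, each with a private point, do not have points
witnessing all of their pairwise intersections. -/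
theorem not_exists_pairwise_private_points (G : Fin 5 → Set ℂ) (hcl : ∀ i, IsClosed (G i))
    (hconn : ∀ i, IsPreconnected (G i))
    (hdiff : Pairwise fun i j => IsPreconnected (G i \ G j))
    (v : Fin 5 → ℂ) (hv : ∀ i k, v i ∈ G k ↔ k = i) :
    ¬ ∃ b : Fin 5 → Fin 5 → ℂ, ∀ i j, i < j → ∀ k, b i j ∈ G k ↔ k = i ∨ k = j := by
  rintro ⟨b, hb⟩
  have hvG : ∀ i, v i ∈ G i := fun i => (hv i i).2 rfl
  have hbl : ∀ i j, i < j → b i j ∈ G i := fun i j h => (hb i j h i).2 (Or.inl rfl)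
  have hbr : ∀ i j, i < j → b i j ∈ G j := fun i j h => (hb i j h j).2 (Or.inr rfl)
  have hvn : ∀ i k, k ≠ i → v i ∉ G k := fun i k h h' => h ((hv i k).1 h')
  have hbn : ∀ i j, i < j → ∀ k, k ≠ i → k ≠ j → b i j ∉ G k := fun i j h k hi hj h' =>
    ((hb i j h k).1 h').elim hi hj
  let T : Set ℂ := range v ∪ range (Function.uncurry b)
  have hT : T.Finite := (finite_range _).union (finite_range _)
  have hvT : ∀ i, v i ∈ T := fun i => Or.inl ⟨i, rfl⟩
  have hbT : ∀ i j, b i j ∈ T := fun i j => Or.inr ⟨(i, j), rfl⟩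
  have hcross : ∀ᶠ η in 𝓝[>] (0 : ℝ), ∀ i k, i ≠ k → ∀ x ∈ T, ∀ y ∈ T, ∀ z ∈ T, ∀ w ∈ T,
      x ∈ G i \ G k → y ∈ G i \ G k → z ∈ G k \ G i → w ∈ G k \ G i →
      ∀ (e : PolygonalPath x y) (f : PolygonalPath z w),
        e.carrier ⊆ thickening η (G i) → f.carrier ⊆ thickening η (G k) → e.crossing f = 0 := by
    simp only [eventually_all, eventually_all_finite hT]
    intro i k hik x _ y _ z _ w _ hx hy hz hw
    exact eventually_crossing_eq_zero_s3 (hcl i) (hcl k) (hdiff hik) (hdiff hik.symm) hx hy hz hw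
  have havoid : ∀ᶠ η in 𝓝[>] (0 : ℝ), ∀ i k, k ≠ i → v k ∉ thickening η (G i) := by
    simp only [eventually_all]
    intro i k hki
    simpa only [disjoint_singleton_left] using isCompact_singleton.eventually_disjoint_thickening
      (hcl i) (disjoint_singleton_left.2 (hvn k i hki.symm))
  obtain ⟨η, ⟨hcross, havoid⟩, hη⟩ :=
    ((hcross.and havoid).and (eventually_mem_nhdsWithin (a := (0 : ℝ)) (s := Ioi 0))).exists
  have hpath : ∀ i x y, x ∈ G i → y ∈ G i →
      ∃ e : PolygonalPath x y, e.carrier ⊆ thickening η (G i) := fun i x y hx hy =>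
    (hconn i).exists_polygonalPath isOpen_thickening (self_subset_thickening hη _) hx hy
  choose P hP using fun i j (h : i < j) => hpath i (v i) (b i j) (hvG i) (hbl i j h)
  choose Q hQ using fun i j (h : i < j) => hpath j (b i j) (v j) (hbr i j h) (hvG j)
  obtain ⟨i, j, k, l, hij, hkl, hik, hil, hjk, hjl, hne⟩ := exists_crossing_ne_zero v
    (fun i j h => (P i j h).append (Q i j h)) fun i j h k hki hkj hk =>
      ((P i j h).carrier_append _ hk).elim (fun hk => havoid i k hki (hP i j h hk))
        fun hk => havoid j k hkj (hQ i j h hk)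
  refine hne ?_
  rw [PolygonalPath.crossing_append_left, PolygonalPath.crossing_append_right,
    PolygonalPath.crossing_append_right,
    hcross i k hik _ (hvT i) _ (hbT i j) _ (hvT k) _ (hbT k l) ⟨hvG i, hvn i k hik.symm⟩
      ⟨hbl i j hij, hbn i j hij k hik.symm hjk.symm⟩ ⟨hvG k, hvn k i hik⟩
      ⟨hbl k l hkl, hbn k l hkl i hik hil⟩ _ _ (hP i j hij) (hP k l hkl),
    hcross i l hil _ (hvT i) _ (hbT i j) _ (hbT k l) _ (hvT l) ⟨hvG i, hvn i l hil.symm⟩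
      ⟨hbl i j hij, hbn i j hij l hil.symm hjl.symm⟩ ⟨hbr k l hkl, hbn k l hkl i hik hil⟩
      ⟨hvG l, hvn l i hil⟩ _ _ (hP i j hij) (hQ k l hkl),
    hcross j k hjk _ (hbT i j) _ (hvT j) _ (hvT k) _ (hbT k l)
      ⟨hbr i j hij, hbn i j hij k hik.symm hjk.symm⟩ ⟨hvG j, hvn j k hjk.symm⟩
      ⟨hvG k, hvn k j hjk⟩ ⟨hbl k l hkl, hbn k l hkl j hjk hjl⟩ _ _ (hQ i j hij) (hP k l hkl),
    hcross j l hjl _ (hbT i j) _ (hvT j) _ (hbT k l) _ (hvT l)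
      ⟨hbr i j hij, hbn i j hij l hil.symm hjl.symm⟩ ⟨hvG j, hvn j l hjl.symm⟩
      ⟨hbr k l hkl, hbn k l hkl j hjk hjl⟩ ⟨hvG l, hvn l j hjl⟩ _ _ (hQ i j hij) (hQ k l hkl)]
  norm_num

/-- The dyadic dual VC-dimension of a non-piercing family of regions in general position
is at most 5: there do not exist six members `F₁, …, F₆` together with points
`a i j ∈ Fᵢ ∩ Fⱼ` (for `i < j`) avoiding all the other four sets. -/
theorem dyadicDualVC_le_five_of_nonPiercing (ℱ : Set (Set Plane))
    (hreg : ∀ F ∈ ℱ, IsRegion F) (hgp : GeneralPosition ℱ) (hnp : NonPiercing ℱ) :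
    ¬ ∃ (F : Fin 6 → Set Plane) (a : Fin 6 → Fin 6 → Plane),
        (∀ i, F i ∈ ℱ) ∧ ∀ i j : Fin 6, i < j →
          a i j ∈ F i ∧ a i j ∈ F j ∧ ∀ k : Fin 6, k ≠ i → k ≠ j → a i j ∉ F k := by
  rintro ⟨F, a, hF, ha⟩
  have hmem : ∀ i j, i < j → ∀ k, a i j ∈ F k ↔ k = i ∨ k = j := fun i j hij k =>
    ⟨fun h => by by_contra! hk; exact (ha i j hij).2.2 k hk.1 hk.2 h,
      fun h => h.elim (fun h => h ▸ (ha i j hij).1) fun h => h ▸ (ha i j hij).2.1⟩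
  have hlast : ∀ i : Fin 5, i.castSucc < Fin.last 5 := Fin.castSucc_lt_last
  have hne : ∀ i k : Fin 5, i ≠ k → F i.castSucc ≠ F k.castSucc := fun i k hik h => by
    have hi := (hmem _ _ (hlast i) i.castSucc).2 (Or.inl rfl)
    rw [h, hmem _ _ (hlast i)] at hi
    exact hi.elim (fun h => hik (Fin.castSucc_injective _ h).symm) (hlast k).ne
  let φ : Plane ≃ₜ ℂ := Complex.equivRealProdCLM.symm.toHomeomorph
  refine not_exists_pairwise_private_points (fun i => φ '' F i.castSucc)
    (fun i => φ.isClosed_image.2 (hreg _ (hF _)).1.isClosed)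
    (fun i => (hreg _ (hF _)).2.1.isPreconnected.image φ φ.continuous.continuousOn)
    (fun i k hik => ?_) (fun i => φ (a i.castSucc (Fin.last 5))) (fun i k => ?_)
    ⟨fun i j => φ (a i.castSucc j.castSucc), fun i j hij k => ?_⟩
  · beta_reduce
    rw [← image_sdiff φ.injective]
    exact (hnp _ (hF _) _ (hF _) (hne i k hik)).isPreconnected.image φ φ.continuous.continuousOn
  · rw [φ.injective.mem_set_image, hmem _ _ (hlast i), Fin.castSucc_inj,
      or_iff_left (hlast k).ne]
  · rw [φ.injective.mem_set_image, hmem _ _ (Fin.castSucc_lt_castSucc_iff.2 hij),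
      Fin.castSucc_inj, Fin.castSucc_inj]
end
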